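/- arXiv:2411.14933 — 9 statements merged into one kernel-verified Lean document; each statement's English description precedes it below -/
import Mathlib

section
/- Let d ≥ 1, let X = {x_1, …, x_N} ⊆ ℝ^d be a finite set of distinct points with separation radius q_X = (1/2) min_{i≠j} ‖x_i − x_j‖_2 > 0, let Ω ⊆ ℝ^d, let ℓ ∈ ℕ, let C > 0, and let φ : ℝ_{≥0} → ℝ be a nonnegative decreasing function such that the series Σ_{n=0}^∞ (n+1)^{d+ℓ−1} φ(n) converges. Suppose u_1, …, u_N : Ω → ℝ satisfy |u_j(x)| ≤ C·φ(‖x − x_j‖_2 / q_X) for all x ∈ Ω and all j. Then for every x ∈ Ω, Σ_{j=1}^N ‖x − x_j‖_2^ℓ · |u_j(x)| ≤ K · q_X^ℓ, where K = 3^d · C · Σ_{n=0}^∞ (n+1)^{d+ℓ−1} φ(n). -/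
open scoped BigOperators

/-- The separation radius `q_X = (1/2) min_{i ≠ j} ‖x_i − x_j‖₂` of a finite family
of points in `ℝ^d`. -/
noncomputable def sepRadius {d N : ℕ} (x : Fin N → EuclideanSpace ℝ (Fin d)) : ℝ :=
  (1 / 2) * sInf {r : ℝ | ∃ i j : Fin N, i ≠ j ∧ r = dist (x i) (x j)}

open MeasureTheory in
lemma aux_card {d N : ℕ} (hd : 1 ≤ d)
    (x : Fin N → EuclideanSpace ℝ (Fin d)) (q : ℝ) (hq0 : 0 < q)
    (hsep : ∀ i j, i ≠ j → 2 * q ≤ dist (x i) (x j))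
    (y : EuclideanSpace ℝ (Fin d)) (r R : ℝ) (hr : 0 ≤ r) (hR : 0 ≤ R) (hrR : r ≤ R)
    (s : Finset (Fin N))
    (hs1 : ∀ j ∈ s, dist y (x j) + q ≤ R * q)
    (hs2 : r = 0 ∨ ∀ j ∈ s, (r + 1) * q ≤ dist y (x j)) :
    (s.card : ℝ) ≤ R ^ d - r ^ d := by
  have hne : Nonempty (Fin d) := ⟨⟨0, hd⟩⟩
  have hfr : Module.finrank ℝ (EuclideanSpace ℝ (Fin d)) = d := by simp
  have hball : ∀ (z : EuclideanSpace ℝ (Fin d)) (t : ℝ), 0 ≤ t →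
      volume.real (Metric.ball z t) = t ^ d * volume.real (Metric.ball (0 : EuclideanSpace ℝ (Fin d)) 1) := by
    intro z t ht
    have := Measure.addHaar_ball (volume : Measure (EuclideanSpace ℝ (Fin d))) z ht
    rw [hfr] at this
    rw [Measure.real, this, ENNReal.toReal_mul, ENNReal.toReal_ofReal (by positivity), Measure.real]
  have hfin : ∀ (z : EuclideanSpace ℝ (Fin d)) (t : ℝ), volume (Metric.ball z t) ≠ ⊤ :=
    fun z t => measure_ball_lt_top.ne
  have hv : 0 < volume.real (Metric.ball (0 : EuclideanSpace ℝ (Fin d)) 1) :=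
    ENNReal.toReal_pos (Metric.measure_ball_pos _ _ one_pos).ne' (hfin _ _)
  set v := volume.real (Metric.ball (0 : EuclideanSpace ℝ (Fin d)) 1) with hvdef
  have hU : volume.real (⋃ j ∈ s, Metric.ball (x j) q) = s.card * (q ^ d * v) := by
    rw [measureReal_biUnion_finset]
    · simp [hball _ _ hq0.le]
    · intro i _ j _ hij
      apply Metric.ball_disjoint_ball
      linarith [hsep i j hij]
    · intro i _
      exact measurableSet_ball
  have hdisj : Disjoint (⋃ j ∈ s, Metric.ball (x j) q) (Metric.ball y (r * q)) := by
    rcases hs2 with h0 | h2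
    · simp [h0]
    · simp only [Set.disjoint_iUnion_left]
      intro j hj
      apply Metric.ball_disjoint_ball
      have := h2 j hj
      rw [dist_comm]
      linarith
  have hUfin : volume (⋃ j ∈ s, Metric.ball (x j) q) ≠ ⊤ :=
    (measure_biUnion_lt_top s.finite_toSet (fun j _ => (hfin _ _).lt_top)).ne
  have hun := measureReal_union (μ := volume) hdisj measurableSet_ball hUfin (hfin _ _)
  have hsub : (⋃ j ∈ s, Metric.ball (x j) q) ∪ Metric.ball y (r * q) ⊆ Metric.ball y (R * q) := by
    apply Set.union_subset
    · apply Set.iUnion₂_subset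
      intro j hj
      apply Metric.ball_subset_ball'
      have := hs1 j hj
      rw [dist_comm]
      linarith
    · exact Metric.ball_subset_ball (by gcongr)
  have hle := measureReal_mono (μ := volume) hsub (hfin _ _)
  rw [hun, hU, hball _ _ (by positivity), hball _ _ (by positivity), mul_pow, mul_pow] at hle
  have hp : 0 < q ^ d * v := by positivity
  have : (s.card + r ^ d) * (q ^ d * v) ≤ R ^ d * (q ^ d * v) := by linarith
  have := le_of_mul_le_mul_right this hp
  linarith

lemma aux_pow (t : ℝ) (ht : 0 ≤ t) (d : ℕ) :
    (t + 3) ^ (d + 1) - t ^ (d + 1) ≤ 3 ^ (d + 1) * (t + 2) ^ d := by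
  induction d with
  | zero => simp
  | succ d ih =>
    have h1 : (t + 3) ^ (d + 1 + 1) - t ^ (d + 1 + 1)
        = (t + 3) * ((t + 3) ^ (d + 1) - t ^ (d + 1)) + 3 * (t ^ d * t) := by ring
    have h2 : (t + 3) * ((t + 3) ^ (d + 1) - t ^ (d + 1))
        ≤ (t + 3) * (3 ^ (d + 1) * (t + 2) ^ d) := by gcongr
    have h3 : t ^ d ≤ (t + 2) ^ d := by gcongr; linarith
    have h4 : (3 : ℝ) ≤ 3 ^ (d + 1) := by
      rw [pow_succ]; nlinarith [one_le_pow₀ (M₀ := ℝ) (a := 3) (n := d) (by norm_num)]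
    have h5 : 3 * (t ^ d * t) ≤ 3 ^ (d + 1) * ((t + 2) ^ d * (2 * t + 3)) := by
      gcongr
      linarith
    rw [h1]
    calc _ ≤ (t + 3) * (3 ^ (d + 1) * (t + 2) ^ d)
          + 3 ^ (d + 1) * ((t + 2) ^ d * (2 * t + 3)) := add_le_add h2 h5
      _ = _ := by ring

/-- Theorem 3.2, stability of fast-decaying polynomial reproduction:
if `|u_j(x)| ≤ C φ(‖x − x_j‖/q_X)` with `φ` nonnegative, decreasing and such that
`Σ (n+1)^{d+ℓ−1} φ(n) < ∞`, then
`Σ_j ‖x − x_j‖^ℓ |u_j(x)| ≤ K q_X^ℓ` with `K = 3^d C Σ_{n} (n+1)^{d+ℓ−1} φ(n)`. -/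
theorem stability_fast_decay {d N : ℕ} (hd : 1 ≤ d)
    (x : Fin N → EuclideanSpace ℝ (Fin d)) (hx : Function.Injective x)
    (Ω : Set (EuclideanSpace ℝ (Fin d))) (ℓ : ℕ)
    (C : ℝ) (hC : 0 < C)
    (φ : ℝ → ℝ) (hφ0 : ∀ t, 0 ≤ t → 0 ≤ φ t)
    (hφdec : ∀ s t, 0 ≤ s → s ≤ t → φ t ≤ φ s)
    (hsum : Summable fun n : ℕ => ((n : ℝ) + 1) ^ (d + ℓ - 1) * φ n)
    (q : ℝ) (hq : q = sepRadius x) (hq0 : 0 < q)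
    (u : Fin N → EuclideanSpace ℝ (Fin d) → ℝ)
    (hu : ∀ j, ∀ y ∈ Ω, |u j y| ≤ C * φ (dist y (x j) / q)) :
    ∀ y ∈ Ω,
      ∑ j, dist y (x j) ^ ℓ * |u j y| ≤
        (3 ^ d * C * ∑' n : ℕ, ((n : ℝ) + 1) ^ (d + ℓ - 1) * φ n) * q ^ ℓ := by
  intro y hy
  have hsep : ∀ i j, i ≠ j → 2 * q ≤ dist (x i) (x j) := by
    intro i j hij
    have hb : BddBelow {r : ℝ | ∃ i j : Fin N, i ≠ j ∧ r = dist (x i) (x j)} := by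
      refine ⟨0, ?_⟩
      rintro r ⟨i, j, _, rfl⟩
      exact dist_nonneg
    have := csInf_le hb ⟨i, j, hij, rfl⟩
    rw [hq, sepRadius]
    linarith
  set n : Fin N → ℕ := fun j => ⌊dist y (x j) / q⌋₊ with hn
  have hn1 : ∀ j, (n j : ℝ) ≤ dist y (x j) / q := fun j => Nat.floor_le (by positivity)
  have hn2 : ∀ j, dist y (x j) / q < n j + 1 := fun j => Nat.lt_floor_add_one _
  have hcard : ∀ m : ℕ, ((Finset.univ.filter (fun j => n j = m)).card : ℝ)
      ≤ 3 ^ d * ((m : ℝ) + 1) ^ (d - 1) := by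
    intro m
    have hs1 : ∀ j ∈ Finset.univ.filter (fun j => n j = m),
        dist y (x j) + q ≤ ((m : ℝ) + 2) * q := by
      intro j hj
      have hj : n j = m := by simpa using hj
      have := hn2 j
      rw [hj, div_lt_iff₀ hq0] at this
      linarith
    obtain ⟨e, rfl⟩ : ∃ e, d = e + 1 := ⟨d - 1, by omega⟩
    rcases m with _ | k
    · have := aux_card hd x q hq0 hsep y 0 _ le_rfl (by positivity) (by positivity) _ hs1 (Or.inl rfl)
      refine this.trans ?_
      have h23 : (2 : ℝ) ^ (e + 1) ≤ 3 ^ (e + 1) := by gcongr; norm_num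
      simpa using h23
    · have := aux_card hd x q hq0 hsep y (k : ℝ) _ (by positivity) (by positivity)
        (by push_cast; linarith) _ hs1 (Or.inr ?_)
      · refine this.trans ?_
        have h := aux_pow (k : ℝ) (by positivity) e
        push_cast
        rw [show (k : ℝ) + 1 + 2 = k + 3 by ring, show (k : ℝ) + 1 + 1 = k + 2 by ring]
        simpa using h
      · intro j hj
        have hj : n j = k + 1 := by simpa using hj
        have := hn1 j
        rw [hj, le_div_iff₀ hq0] at this
        push_cast at this
        exact this
  have hterm : ∀ j, dist y (x j) ^ ℓ * |u j y|
      ≤ ((n j : ℝ) + 1) ^ ℓ * φ (n j) * (C * q ^ ℓ) := by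
    intro j
    have h1 : dist y (x j) ≤ ((n j : ℝ) + 1) * q := by
      have := (hn2 j).le
      rwa [div_le_iff₀ hq0] at this
    have h2 : |u j y| ≤ C * φ (n j) :=
      (hu j y hy).trans (by gcongr; exact hφdec _ _ (by positivity) (hn1 j))
    calc _ ≤ (((n j : ℝ) + 1) * q) ^ ℓ * (C * φ (n j)) := by gcongr
      _ = _ := by rw [mul_pow]; ring
  have hnn : ∀ m : ℕ, 0 ≤ φ m := fun m => hφ0 _ (by positivity)
  calc ∑ j, dist y (x j) ^ ℓ * |u j y|
      ≤ ∑ j, ((n j : ℝ) + 1) ^ ℓ * φ (n j) * (C * q ^ ℓ) := Finset.sum_le_sum fun j _ => hterm j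
    _ = ∑ m ∈ Finset.univ.image n, ∑ j with n j = m,
          ((n j : ℝ) + 1) ^ ℓ * φ (n j) * (C * q ^ ℓ) :=
        (Finset.sum_fiberwise_of_maps_to (fun j _ => Finset.mem_image_of_mem n (Finset.mem_univ j)) _).symm
    _ ≤ ∑ m ∈ Finset.univ.image n,
          (3 ^ d * C * q ^ ℓ) * (((m : ℝ) + 1) ^ (d + ℓ - 1) * φ m) := by
        apply Finset.sum_le_sum
        intro m _
        have : ∑ j with n j = m, ((n j : ℝ) + 1) ^ ℓ * φ (n j) * (C * q ^ ℓ)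
            = ∑ j with n j = m, ((m : ℝ) + 1) ^ ℓ * φ m * (C * q ^ ℓ) := by
          apply Finset.sum_congr rfl
          intro j hj
          rw [(Finset.mem_filter.mp hj).2]
        rw [this, Finset.sum_const, nsmul_eq_mul]
        have hm := hnn m
        calc _ ≤ (3 ^ d * ((m : ℝ) + 1) ^ (d - 1)) * (((m : ℝ) + 1) ^ ℓ * φ m * (C * q ^ ℓ)) := by
              gcongr
              exact hcard m
          _ = _ := by
              rw [show d + ℓ - 1 = (d - 1) + ℓ by omega, pow_add]; ring
    _ = (3 ^ d * C * q ^ ℓ) * ∑ m ∈ Finset.univ.image n,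
          (((m : ℝ) + 1) ^ (d + ℓ - 1) * φ m) := by rw [Finset.mul_sum]
    _ ≤ (3 ^ d * C * q ^ ℓ) * ∑' m : ℕ, ((m : ℝ) + 1) ^ (d + ℓ - 1) * φ m := by
        gcongr
        exact hsum.sum_le_tsum _ (fun m _ => mul_nonneg (by positivity) (hnn m))
    _ = _ := by ring
end

section
/- Let d ≥ 1, let X = {x_1, …, x_N} ⊆ ℝ^d be a finite set of distinct points with separation radius q_X > 0, let Ω ⊆ ℝ^d, let C > 0, and let φ : ℝ_{≥0} → ℝ be a nonnegative decreasing function such that the series Σ_{n=0}^∞ (n+1)^{d−1} φ(n) converges. Suppose u_1, …, u_N : Ω → ℝ satisfy |u_j(x)| ≤ C·φ(‖x − x_j‖_2 / q_X) for all x ∈ Ω and all j. Then the Lebesgue function is uniformly bounded: for every x ∈ Ω, Σ_{j=1}^N |u_j(x)| ≤ 3^d · C · Σ_{n=0}^∞ (n+1)^{d−1} φ(n). -/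
open scoped BigOperators

open MeasureTheory in
lemma packing_aux {d N : ℕ} (hd : 1 ≤ d) (x : Fin N → EuclideanSpace ℝ (Fin d)) (q : ℝ) (hq0 : 0 < q)
    (hsep : ∀ i j, i ≠ j → 2 * q ≤ dist (x i) (x j)) (y : EuclideanSpace ℝ (Fin d))
    (S : Finset (Fin N)) (m R : ℕ) (hm : m = 0 ∨ ∀ j ∈ S, ((m : ℝ) + 1) * q ≤ dist y (x j))
    (hmR : m ≤ R)
    (hR : ∀ j ∈ S, dist y (x j) ≤ ((R : ℝ) - 1) * q) :
    (S.card : ℝ) + (m : ℝ) ^ d ≤ (R : ℝ) ^ d := by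
  haveI : Nonempty (Fin d) := ⟨⟨0, hd⟩⟩
  have hvol : ∀ (z : EuclideanSpace ℝ (Fin d)) (r : ℝ), 0 ≤ r → volume.real (Metric.ball z r)
      = r ^ d * volume.real (Metric.ball (0 : EuclideanSpace ℝ (Fin d)) 1) := by
    intro z r hr
    rw [measureReal_def, Measure.addHaar_ball volume z hr, ENNReal.toReal_mul,
      ENNReal.toReal_ofReal (by positivity), finrank_euclideanSpace_fin, measureReal_def]
  have hv : 0 < volume.real (Metric.ball (0 : EuclideanSpace ℝ (Fin d)) 1) :=
    ENNReal.toReal_pos (Metric.measure_ball_pos volume _ one_pos).ne' measure_ball_lt_top.ne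
  set v := volume.real (Metric.ball (0 : EuclideanSpace ℝ (Fin d)) 1)
  set U := ⋃ j ∈ S, Metric.ball (x j) q with hU
  have hUm : MeasurableSet U := Finset.measurableSet_biUnion _ fun _ _ => measurableSet_ball
  have h1 : volume.real U = S.card * (q ^ d * v) := by
    rw [hU, measureReal_biUnion_finset]
    · simp [hvol _ q hq0.le]
    · intro i _ j _ hij
      exact Metric.ball_disjoint_ball (by linarith [hsep i j hij])
    · exact fun _ _ => measurableSet_ball
  have hsubU : U ⊆ Metric.ball y (R * q) := by
    refine Set.iUnion₂_subset fun j hj => Metric.ball_subset_ball' ?_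
    have := hR j hj
    rw [dist_comm] at this
    linarith
  have hsub2 : Metric.ball y (m * q) ⊆ Metric.ball y (R * q) :=
    Metric.ball_subset_ball (by gcongr)
  have hdis : Disjoint (Metric.ball y (m * q)) U := by
    rcases hm with rfl | hm
    · simp
    · rw [hU, Set.disjoint_iUnion₂_right]
      intro j hj
      exact Metric.ball_disjoint_ball (by linarith [hm j hj])
  have hfin : volume U ≠ ⊤ := ((measure_mono hsubU).trans_lt measure_ball_lt_top).ne
  have h2 : volume.real (Metric.ball y (m * q) ∪ U) = _ :=
    measureReal_union hdis hUm measure_ball_lt_top.ne hfin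
  have h3 : volume.real (Metric.ball y (m * q) ∪ U) ≤ volume.real (Metric.ball y (R * q)) :=
    measureReal_mono (Set.union_subset hsub2 hsubU) measure_ball_lt_top.ne
  rw [h2, h1, hvol _ _ (by positivity), hvol _ _ (by positivity), mul_pow, mul_pow] at h3
  have h4 : 0 < q ^ d * v := by positivity
  refine le_of_mul_le_mul_right ?_ h4
  linarith

lemma pow_aux (k : ℕ) (t : ℝ) (ht : 0 ≤ t) :
    (t + 3) ^ (k + 1) - t ^ (k + 1) ≤ 3 ^ (k + 1) * (t + 1) ^ k := by
  induction k with
  | zero => norm_num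
  | succ k ih =>
    have h1 : t ^ k ≤ (t + 1) ^ k := by gcongr; linarith
    have h2 : (1 : ℝ) ≤ 3 ^ k := one_le_pow₀ (by norm_num)
    have h3 : t ^ k ≤ 3 ^ k * (t + 1) ^ k := by
      have : 0 ≤ (t + 1) ^ k := by positivity
      nlinarith
    have h4 := mul_le_mul_of_nonneg_left ih (by linarith : 0 ≤ t + 3)
    have h5 := mul_le_mul_of_nonneg_left h3 ht
    have h6 : 0 ≤ t * (3 ^ k * (t + 1) ^ k) := by positivity
    have e1 : (t + 3) ^ (k + 1 + 1) - t ^ (k + 1 + 1)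
      = (t + 3) * ((t + 3) ^ (k + 1) - t ^ (k + 1)) + 3 * (t * t ^ k) := by ring
    have e2 : (3 : ℝ) ^ (k + 1 + 1) * (t + 1) ^ (k + 1)
      = (t + 3) * (3 ^ (k + 1) * (t + 1) ^ k) + 6 * (t * (3 ^ k * (t + 1) ^ k)) := by ring
    rw [e1, e2]
    linarith

/-- uniform bound of the Lebesgue function for a fast-decaying family:
`Σ_j |u_j(x)| ≤ 3^d C Σ_{n=0}^∞ (n+1)^{d−1} φ(n)`. -/
theorem lebesgue_function_bound_fast_decay {d N : ℕ} (hd : 1 ≤ d)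
    (x : Fin N → EuclideanSpace ℝ (Fin d)) (hx : Function.Injective x)
    (Ω : Set (EuclideanSpace ℝ (Fin d)))
    (C : ℝ) (hC : 0 < C)
    (φ : ℝ → ℝ) (hφ0 : ∀ t, 0 ≤ t → 0 ≤ φ t)
    (hφdec : ∀ s t, 0 ≤ s → s ≤ t → φ t ≤ φ s)
    (hsum : Summable fun n : ℕ => ((n : ℝ) + 1) ^ (d - 1) * φ n)
    (q : ℝ) (hq : q = sepRadius x) (hq0 : 0 < q)
    (u : Fin N → EuclideanSpace ℝ (Fin d) → ℝ)
    (hu : ∀ j, ∀ y ∈ Ω, |u j y| ≤ C * φ (dist y (x j) / q)) :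
    ∀ y ∈ Ω,
      ∑ j, |u j y| ≤ 3 ^ d * C * ∑' n : ℕ, ((n : ℝ) + 1) ^ (d - 1) * φ n := by
  intro y hy
  have hsep : ∀ i j, i ≠ j → 2 * q ≤ dist (x i) (x j) := by
    intro i j hij
    have : sInf {r : ℝ | ∃ i j : Fin N, i ≠ j ∧ r = dist (x i) (x j)} ≤ dist (x i) (x j) := by
      apply csInf_le
      · exact ⟨0, by rintro r ⟨i, j, _, rfl⟩; exact dist_nonneg⟩
      · exact ⟨i, j, hij, rfl⟩
    rw [hq, sepRadius]
    linarith
  let f : Fin N → ℕ := fun j => ⌊dist y (x j) / q⌋₊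
  have hf1 : ∀ j, (f j : ℝ) ≤ dist y (x j) / q := fun j => Nat.floor_le (by positivity)
  have hf2 : ∀ j, dist y (x j) / q < f j + 1 := fun j => Nat.lt_floor_add_one _
  have hcard : ∀ n : ℕ, ((Finset.univ.filter fun j => f j = n).card : ℝ)
      ≤ 3 ^ d * ((n : ℝ) + 1) ^ (d - 1) := by
    intro n
    obtain ⟨k, rfl⟩ : ∃ k, d = k + 1 := ⟨d - 1, by omega⟩
    have hR : ∀ j ∈ Finset.univ.filter (fun j => f j = n),
        dist y (x j) ≤ (((n + 2 : ℕ) : ℝ) - 1) * q := by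
      intro j hj
      have hj' : f j = n := by simpa using hj
      have := hf2 j
      rw [hj', div_lt_iff₀ hq0] at this
      push_cast
      linarith
    rcases n with _ | n
    · have := packing_aux hd x q hq0 hsep y _ 0 _ (Or.inl rfl) (by omega) hR
      have h2 : (2 : ℝ) ^ (k + 1) ≤ 3 ^ (k + 1) := by gcongr; norm_num
      norm_num at this ⊢
      linarith
    · have := packing_aux hd x q hq0 hsep y _ n _ (Or.inr (by
        intro j hj
        have hj' : f j = n + 1 := by simpa using hj
        have := hf1 j
        rw [hj', le_div_iff₀ hq0] at this
        push_cast at this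
        exact this)) (by omega) hR
      have h2 := pow_aux k n (Nat.cast_nonneg n)
      have h3 : (n + 1 : ℝ) ^ k ≤ (((n + 1 : ℕ) : ℝ) + 1) ^ k := by
        gcongr
        push_cast
        linarith
      have h4 : (3 : ℝ) ^ (k + 1) * (n + 1 : ℝ) ^ k
          ≤ 3 ^ (k + 1) * (((n + 1 : ℕ) : ℝ) + 1) ^ k := by gcongr
      have h5 : (((n + 1 + 2 : ℕ) : ℝ)) = n + 3 := by push_cast; ring
      rw [h5] at this
      simp only [Nat.add_sub_cancel]
      linarith
  let T := Finset.univ.image f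
  have hmaps : ∀ j ∈ (Finset.univ : Finset (Fin N)), f j ∈ T := fun j _ =>
    Finset.mem_image_of_mem _ (Finset.mem_univ _)
  calc ∑ j, |u j y| ≤ ∑ j, C * φ (f j) := by
        refine Finset.sum_le_sum fun j _ => (hu j y hy).trans ?_
        exact mul_le_mul_of_nonneg_left (hφdec _ _ (Nat.cast_nonneg _) (hf1 j)) hC.le
    _ = ∑ n ∈ T, ∑ j ∈ Finset.univ.filter (fun j => f j = n), C * φ (f j) :=
        (Finset.sum_fiberwise_of_maps_to hmaps _).symm
    _ = ∑ n ∈ T, ((Finset.univ.filter fun j => f j = n).card : ℝ) * (C * φ n) := by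
        refine Finset.sum_congr rfl fun n _ => ?_
        rw [← nsmul_eq_mul, ← Finset.sum_const]
        refine Finset.sum_congr rfl fun j hj => ?_
        have hj' : f j = n := by simpa using hj
        rw [hj']
    _ ≤ ∑ n ∈ T, (3 ^ d * ((n : ℝ) + 1) ^ (d - 1)) * (C * φ n) := by
        refine Finset.sum_le_sum fun n _ => mul_le_mul_of_nonneg_right (hcard n) ?_
        exact mul_nonneg hC.le (hφ0 _ (Nat.cast_nonneg _))
    _ = 3 ^ d * C * ∑ n ∈ T, ((n : ℝ) + 1) ^ (d - 1) * φ n := by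
        rw [Finset.mul_sum]
        exact Finset.sum_congr rfl fun n _ => by ring
    _ ≤ _ := by
        refine mul_le_mul_of_nonneg_left (hsum.sum_le_tsum T fun n _ => ?_) (by positivity)
        exact mul_nonneg (by positivity) (hφ0 _ (Nat.cast_nonneg _))
end

section
/- Let d ≥ 1, m ∈ ℕ, let Ω ⊆ ℝ^d be bounded and let Ω* be the closure of the convex hull of Ω. Let X = {x_1, …, x_N} ⊆ Ω be a finite set of distinct points with separation radius q_X > 0 and fill distance h = h_{X,Ω}, with q_X ≤ h. Let C > 0 and let φ : ℝ_{≥0} → ℝ be a nonnegative decreasing function with Σ_{n=0}^∞ (n+1)^{d+m} φ(n) < ∞. Suppose u_1, …, u_N : Ω → ℝ satisfy (i) Σ_{j=1}^N p(x_j) u_j(x) = p(x) for all x ∈ Ω and every polynomial p of degree at most m on ℝ^d, and (ii) |u_j(x)| ≤ C·φ(‖x − x_j‖_2 / q_X) for all x ∈ Ω and all j. If f : ℝ^d → ℝ is (m+1)-times continuously differentiable on a neighborhood of Ω* with |f|_{C^{m+1}(Ω*)} = max_{|α| = m+1} sup_{ξ ∈ Ω*} |D^α f(ξ)| < ∞,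 then for every x ∈ Ω, |f(x) − Σ_{j=1}^N f(x_j) u_j(x)| ≤ (Σ_{|α| = m+1} 1/α!) · K · |f|_{C^{m+1}(Ω*)} · h^{m+1}, where K = 3^d · C · Σ_{n=0}^∞ (n+1)^{d+m} φ(n) and the sum over α ranges over multi-indices α ∈ ℕ^d with |α| = m+1. -/
open scoped BigOperators

/-- The fill distance `h_{X,Ω} = sup_{y ∈ Ω} min_j ‖y − x_j‖₂`. -/
noncomputable def fillDist {d N : ℕ} (x : Fin N → EuclideanSpace ℝ (Fin d))
    (Ω : Set (EuclideanSpace ℝ (Fin d))) : ℝ :=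
  ⨆ y ∈ Ω, ⨅ j, dist y (x j)

/-- The partial derivative in the `k`-th coordinate direction. -/
noncomputable def pderivCoord {d : ℕ} (k : Fin d) (f : EuclideanSpace ℝ (Fin d) → ℝ) :
    EuclideanSpace ℝ (Fin d) → ℝ :=
  fun y => fderiv ℝ f y (EuclideanSpace.single k 1)

/-- The multi-index partial derivative `D^α f` for a multi-index `α : Fin d → ℕ`. -/
noncomputable def mderiv {d : ℕ} (α : Fin d → ℕ) (f : EuclideanSpace ℝ (Fin d) → ℝ) :
    EuclideanSpace ℝ (Fin d) → ℝ :=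
  (List.finRange d).foldr (fun k g => (pderivCoord k)^[α k] g) f

/-- The (finite) set of multi-indices `α : Fin d → ℕ` with `|α| = s`. -/
def multiIdx (d s : ℕ) : Finset (Fin d → ℕ) :=
  (Fintype.piFinset fun _ : Fin d => Finset.range (s + 1)).filter fun α => ∑ k, α k = s
lemma cfd_ineq (a : ℝ) (ha : 0 ≤ a) (e : ℕ) :
    (a + 3) ^ (e + 1) - a ^ (e + 1) ≤ 3 ^ (e + 1) * (a + 1) ^ e := by
  induction e with
  | zero => norm_num
  | succ e ih =>
    have h1 : a ^ (e + 1) ≤ (a + 1) ^ e * a := by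
      rw [pow_succ]
      exact mul_le_mul_of_nonneg_right (pow_le_pow_left₀ ha (by linarith) e) ha
    have h2 : (3:ℝ) ≤ 3 ^ (e + 1) := by
      rw [pow_succ]
      have : (1:ℝ) ≤ 3 ^ e := one_le_pow₀ (by norm_num)
      linarith
    have h3 : 0 ≤ (a + 1) ^ e * a := by positivity
    have h4 : 3 * ((a + 1) ^ e * a) ≤ 3 ^ (e + 1) * ((a + 1) ^ e * a) :=
      mul_le_mul_of_nonneg_right h2 h3
    have h5 := mul_le_mul_of_nonneg_left ih (by linarith : (0:ℝ) ≤ a + 3)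
    have e1 : (a + 3) ^ (e + 1 + 1) = (a + 3) * (a + 3) ^ (e + 1) := by ring
    have e2 : a ^ (e + 1 + 1) = a * a ^ (e + 1) := by ring
    have e3 : (3:ℝ) ^ (e + 1 + 1) * (a + 1) ^ (e + 1)
        = 3 ^ (e + 1) * (a + 1) ^ e * (3 * a + 3) := by ring
    rw [e1, e2, e3]
    nlinarith [mul_nonneg (by positivity : (0:ℝ) ≤ 3 ^ (e + 1)) h3]

/-- one dimensional Taylor bound -/
lemma cfd_taylor (m : ℕ) (T : ℕ → ℝ → ℝ) (B : ℝ)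
    (hT : ∀ k ≤ m, ∀ t ∈ Set.Icc (0:ℝ) 1, HasDerivAt (T k) ((k + 1) * T (k + 1) t) t)
    (hB : ∀ t ∈ Set.Icc (0:ℝ) 1, |T (m + 1) t| ≤ B) :
    |T 0 1 - ∑ k ∈ Finset.range (m + 1), T k 0| ≤ B := by
  have key : ∀ n ≤ m, ∀ t ∈ Set.Icc (0:ℝ) 1,
      HasDerivAt (fun t => ∑ k ∈ Finset.range (n + 1), T k t * (1 - t) ^ k)
        ((n + 1) * T (n + 1) t * (1 - t) ^ n) t := by
    intro n
    induction n with
    | zero =>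
      intro hn t ht
      simpa using hT 0 (by omega) t ht
    | succ n ih =>
      intro hn t ht
      have h1 := ih (by omega) t ht
      have h2 := hT (n + 1) hn t ht
      have h3 : HasDerivAt (fun t : ℝ => (1 - t) ^ (n + 1)) (((n + 1 : ℕ) : ℝ) * (1 - t) ^ n * (-1)) t := by
        have := ((hasDerivAt_id t).const_sub 1).pow (n + 1)
        exact this.congr_deriv (by simp)
      have h4 := h1.add (h2.mul h3)
      have e : (fun t => ∑ k ∈ Finset.range (n + 1 + 1), T k t * (1 - t) ^ k) =
        (fun t => ∑ k ∈ Finset.range (n + 1), T k t * (1 - t) ^ k) + (T (n+1) * fun t : ℝ => (1 - t) ^ (n + 1)) := by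
        funext t
        simp [Finset.sum_range_succ _ (n + 1)]
      rw [e]
      refine h4.congr_deriv ?_
      push_cast
      ring
  have hb : ∀ t, HasDerivAt (fun t : ℝ => |T 0 0 * 0| + (B - B * (1 - t) ^ (m + 1)))
      (B * ((m + 1) * (1 - t) ^ m)) t := by
    intro t
    have := ((((hasDerivAt_id t).const_sub 1).pow (m + 1)).const_mul B).const_sub B
    have := this.const_add (|T 0 0 * 0|)
    refine (this.congr_deriv ?_)
    simp
  have hF := fun t ht => key m le_rfl t ht
  set F : ℝ → ℝ := fun t => ∑ k ∈ Finset.range (m + 1), T k t * (1 - t) ^ k with hFdef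
  have := image_norm_le_of_norm_deriv_right_le_deriv_boundary (a := 0) (b := 1)
    (f := fun t => F t - F 0) (f' := fun t => (m + 1) * T (m + 1) t * (1 - t) ^ m)
    (fun t ht => ((hF t ht).sub_const (F 0)).continuousAt.continuousWithinAt)
    (fun t ht => ((hF t ⟨ht.1, ht.2.le⟩).sub_const (F 0)).hasDerivWithinAt)
    (B := fun t : ℝ => |T 0 0 * 0| + (B - B * (1 - t) ^ (m + 1)))
    (by simp) hb (by
      intro t ht
      have h1 := hB t ⟨ht.1, ht.2.le⟩
      have h2 : 0 ≤ 1 - t := by linarith [ht.2]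
      have h3 : 0 ≤ (m + 1 : ℝ) * (1 - t) ^ m := by positivity
      have : (m + 1 : ℝ) * T (m + 1) t * (1 - t) ^ m = T (m + 1) t * ((m + 1 : ℝ) * (1 - t) ^ m) := by ring
      rw [this, Real.norm_eq_abs, abs_mul, abs_of_nonneg h3]
      exact mul_le_mul_of_nonneg_right h1 h3)
    (show (1:ℝ) ∈ Set.Icc (0:ℝ) 1 by simp)
  have e1 : F 1 = T 0 1 := by
    simp [hFdef, Finset.sum_range_succ']
  have e0 : F 0 = ∑ k ∈ Finset.range (m + 1), T k 0 := by simp [hFdef]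
  simp only [e1, e0, Real.norm_eq_abs] at this
  simpa using this

noncomputable def cfdD {d : ℕ} (l : List (Fin d)) (f : EuclideanSpace ℝ (Fin d) → ℝ) :
    EuclideanSpace ℝ (Fin d) → ℝ :=
  l.foldr pderivCoord f

lemma cfd_pderiv_contDiffOn {d n : ℕ} {U : Set (EuclideanSpace ℝ (Fin d))} (hU : IsOpen U)
    {f : EuclideanSpace ℝ (Fin d) → ℝ} (hf : ContDiffOn ℝ ((n + 1 : ℕ)) f U) (k : Fin d) :
    ContDiffOn ℝ (n : ℕ) (pderivCoord k f) U := by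
  have h := hf.fderiv_of_isOpen (m := (n : ℕ)) hU (by norm_cast)
  exact h.clm_apply contDiffOn_const

lemma cfd_D_contDiffOn {d : ℕ} {U : Set (EuclideanSpace ℝ (Fin d))} (hU : IsOpen U)
    {f : EuclideanSpace ℝ (Fin d) → ℝ} (l : List (Fin d)) (n : ℕ)
    (hf : ContDiffOn ℝ ((n + l.length : ℕ)) f U) :
    ContDiffOn ℝ (n : ℕ) (cfdD l f) U := by
  induction l generalizing n with
  | nil => simpa [cfdD] using hf
  | cons k l ih =>
    have := ih (n + 1) (by
      have e : n + 1 + l.length = n + (k :: l).length := by simp; omega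
      rwa [e])
    exact cfd_pderiv_contDiffOn hU this k

lemma cfd_pderiv_congr {d : ℕ} {U : Set (EuclideanSpace ℝ (Fin d))} (hU : IsOpen U)
    {f g : EuclideanSpace ℝ (Fin d) → ℝ} (h : Set.EqOn f g U) (k : Fin d) :
    Set.EqOn (pderivCoord k f) (pderivCoord k g) U := by
  intro z hz
  have : f =ᶠ[nhds z] g := Filter.eventuallyEq_of_mem (hU.mem_nhds hz) h
  simp [pderivCoord, this.fderiv_eq]

lemma cfd_pderiv_comm {d : ℕ} {U : Set (EuclideanSpace ℝ (Fin d))} (hU : IsOpen U)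
    {f : EuclideanSpace ℝ (Fin d) → ℝ} (hf : ContDiffOn ℝ (2 : ℕ) f U) (i j : Fin d) :
    Set.EqOn (pderivCoord i (pderivCoord j f)) (pderivCoord j (pderivCoord i f)) U := by
  intro z hz
  have hfz : ContDiffAt ℝ (2 : ℕ) f z := hf.contDiffAt (hU.mem_nhds hz)
  have hs : IsSymmSndFDerivAt ℝ f z := hfz.isSymmSndFDerivAt (by simp)
  have hd : DifferentiableAt ℝ (fderiv ℝ f) z :=
    (hfz.fderiv_right (m := 1) (by norm_num)).differentiableAt (by norm_num)
  have e : ∀ i j : Fin d, pderivCoord i (pderivCoord j f) z =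
      fderiv ℝ (fderiv ℝ f) z (EuclideanSpace.single i 1) (EuclideanSpace.single j 1) := by
    intro i j
    unfold pderivCoord
    rw [fderiv_clm_apply hd (differentiableAt_const _)]
    simp
  rw [e, e]
  exact hs _ _

lemma cfd_D_perm {d : ℕ} {U : Set (EuclideanSpace ℝ (Fin d))} (hU : IsOpen U)
    {f : EuclideanSpace ℝ (Fin d) → ℝ} {l l' : List (Fin d)} (h : l.Perm l')
    (hf : ContDiffOn ℝ (l.length : ℕ) f U) :
    Set.EqOn (cfdD l f) (cfdD l' f) U := by
  induction h with
  | nil => exact fun _ _ => rfl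
  | cons k h ih =>
    exact cfd_pderiv_congr hU (ih (hf.of_le (by simp))) k
  | swap i j l =>
    refine cfd_pderiv_comm hU (cfd_D_contDiffOn hU l 2 ?_) _ _
    refine hf.of_le ?_
    simp only [List.length_cons]
    norm_cast
    omega
  | trans h1 h2 ih1 ih2 =>
    exact (ih1 hf).trans (ih2 (by rwa [← h1.length_eq]))

def cfdL {d : ℕ} (α : Fin d → ℕ) : List (Fin d) :=
  (List.finRange d).flatMap fun k => List.replicate (α k) k

lemma cfd_mderiv_eq {d : ℕ} (α : Fin d → ℕ) (f : EuclideanSpace ℝ (Fin d) → ℝ) :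
    mderiv α f = cfdD (cfdL α) f := by
  have hr : ∀ (n : ℕ) (k : Fin d) (g : EuclideanSpace ℝ (Fin d) → ℝ),
      (pderivCoord k)^[n] g = (List.replicate n k).foldr pderivCoord g := by
    intro n k g
    induction n with
    | zero => rfl
    | succ n ih => rw [Function.iterate_succ_apply', ih]; rfl
  unfold mderiv cfdD cfdL
  induction List.finRange d with
  | nil => rfl
  | cons k l ih => simp only [List.foldr_cons, List.flatMap_cons, List.foldr_append]; rw [ih, hr]

lemma cfd_count {d : ℕ} (α : Fin d → ℕ) (i : Fin d) : (cfdL α).count i = α i := by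
  unfold cfdL
  rw [List.count_flatMap]
  have : (List.map (List.count i ∘ fun k => List.replicate (α k) k) (List.finRange d)).sum
      = ∑ k, if k = i then α k else 0 := by
    rw [← List.sum_ofFn, List.ofFn_eq_map]
    congr 1
    apply List.map_congr_left
    intro k _
    simp [List.count_replicate]
  rw [this]
  simp

lemma cfd_length {d : ℕ} (α : Fin d → ℕ) : (cfdL α).length = ∑ k, α k := by
  unfold cfdL
  rw [List.length_flatMap, ← List.sum_ofFn, List.ofFn_eq_map]
  simp

lemma cfd_mderiv_succ {d m : ℕ} {U : Set (EuclideanSpace ℝ (Fin d))} (hU : IsOpen U)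
    {f : EuclideanSpace ℝ (Fin d) → ℝ} (hf : ContDiffOn ℝ ((m + 1 : ℕ)) f U)
    (α : Fin d → ℕ) (hα : ∑ k, α k ≤ m) (i : Fin d) :
    Set.EqOn (pderivCoord i (mderiv α f)) (mderiv (α + Pi.single i 1) f) U := by
  rw [cfd_mderiv_eq, cfd_mderiv_eq]
  have hp : (i :: cfdL α).Perm (cfdL (α + Pi.single i 1)) := by
    rw [List.perm_iff_count]
    intro j
    rw [cfd_count, List.count_cons, cfd_count]
    by_cases h : i = j
    · subst h; simp
    · have : j ≠ i := fun h' => h h'.symm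
      simp [h, this]
  refine cfd_D_perm hU hp (hf.of_le ?_)
  simp only [List.length_cons, cfd_length]
  norm_cast
  omega

lemma cfd_mderiv_diff {d m : ℕ} {U : Set (EuclideanSpace ℝ (Fin d))} (hU : IsOpen U)
    {f : EuclideanSpace ℝ (Fin d) → ℝ} (hf : ContDiffOn ℝ ((m + 1 : ℕ)) f U)
    (α : Fin d → ℕ) (hα : ∑ k, α k ≤ m) {z : EuclideanSpace ℝ (Fin d)} (hz : z ∈ U) :
    DifferentiableAt ℝ (mderiv α f) z := by
  rw [cfd_mderiv_eq]
  have := cfd_D_contDiffOn hU (cfdL α) 1 (hf.of_le (by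
    rw [cfd_length]; norm_cast; omega))
  exact (this.contDiffAt (hU.mem_nhds hz)).differentiableAt (by norm_num)

lemma cfd_mem {d s : ℕ} (α : Fin d → ℕ) : α ∈ multiIdx d s ↔ ∑ k, α k = s := by
  unfold multiIdx
  simp only [Finset.mem_filter, Fintype.mem_piFinset, Finset.mem_range, and_iff_right_iff_imp]
  intro h k
  have := Finset.single_le_sum (f := α) (fun _ _ => Nat.zero_le _) (Finset.mem_univ k)
  omega

noncomputable def cfdc {d : ℕ} (α : Fin d → ℕ) : ℝ :=
  (1 : ℝ) / ((∏ k, Nat.factorial (α k) : ℕ) : ℝ)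

lemma cfd_fact {d : ℕ} (α : Fin d → ℕ) (i : Fin d) :
    cfdc α = ((α i : ℝ) + 1) * cfdc (α + Pi.single i 1) := by
  unfold cfdc
  have h : (∏ k, Nat.factorial ((α + Pi.single i 1 : Fin d → ℕ) k)) = (α i + 1) * ∏ k, Nat.factorial (α k) := by
    rw [← Finset.mul_prod_erase _ _ (Finset.mem_univ i),
      ← Finset.mul_prod_erase _ (fun k => Nat.factorial (α k)) (Finset.mem_univ i)]
    rw [← mul_assoc]
    congr 1
    · simp [Nat.factorial_succ]
    · apply Finset.prod_congr rfl
      intro k hk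
      simp [Finset.ne_of_mem_erase hk]
  rw [h]
  have h0 : ((∏ k, Nat.factorial (α k) : ℕ) : ℝ) ≠ 0 := by
    exact_mod_cast Finset.prod_ne_zero_iff.mpr fun k _ => Nat.factorial_ne_zero _
  have h1 : (α i : ℝ) + 1 ≠ 0 := by positivity
  rw [Nat.cast_mul]
  push_cast at h0 ⊢
  field_simp

lemma cfd_vpow {d : ℕ} (α : Fin d → ℕ) (i : Fin d) (v : Fin d → ℝ) :
    ∏ k, v k ^ ((α + Pi.single i 1 : Fin d → ℕ) k) = v i * ∏ k, v k ^ α k := by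
  simp only [Pi.add_apply, pow_add, Finset.prod_mul_distrib]
  rw [mul_comm]
  congr 1
  rw [Finset.prod_eq_single i]
  · simp
  · intro k _ hk; simp [hk]
  · simp

lemma cfd_resum {d s : ℕ} (G : (Fin d → ℕ) → ℝ) :
    ∑ α ∈ multiIdx d s, ∑ i, ((α i : ℝ) + 1) * G (α + Pi.single i 1)
      = ((s : ℝ) + 1) * ∑ β ∈ multiIdx d (s + 1), G β := by
  have h1 : ((s : ℝ) + 1) * ∑ β ∈ multiIdx d (s + 1), G β
      = ∑ β ∈ multiIdx d (s + 1), ∑ i, (β i : ℝ) * G β := by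
    rw [Finset.mul_sum]
    apply Finset.sum_congr rfl
    intro β hβ
    rw [cfd_mem] at hβ
    rw [← Finset.sum_mul]
    congr 1
    exact_mod_cast hβ.symm
  rw [h1, Finset.sum_comm, Finset.sum_comm (s := multiIdx d (s + 1))]
  apply Finset.sum_congr rfl
  intro i _
  have h2 : ∑ β ∈ multiIdx d (s + 1), (β i : ℝ) * G β
      = ∑ β ∈ (multiIdx d (s + 1)).filter (fun β => β i ≠ 0), (β i : ℝ) * G β := by
    rw [Finset.sum_filter_of_ne]
    intro β _ h h0
    simp [h0] at h
  rw [h2]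
  refine Finset.sum_bij' (fun α _ => α + Pi.single i 1) (fun β _ => β - Pi.single i 1) ?_ ?_ ?_ ?_ ?_
  · intro α hα
    rw [cfd_mem] at hα
    simp [cfd_mem, Finset.sum_add_distrib, hα]
  · intro β hβ
    rw [Finset.mem_filter, cfd_mem] at hβ
    rw [cfd_mem]
    have hle : Pi.single i 1 ≤ β := by
      intro k
      by_cases hk : k = i
      · subst hk; simp; omega
      · simp [hk]
    have : ∑ k, (β - Pi.single i 1 + Pi.single i 1 : Fin d → ℕ) k = s + 1 := by
      rw [tsub_add_cancel_of_le hle]; exact hβ.1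
    simp only [Pi.add_apply, Finset.sum_add_distrib] at this
    simp at this
    simpa using this
  · intro α _
    simp
  · intro β hβ
    rw [Finset.mem_filter] at hβ
    apply tsub_add_cancel_of_le
    intro k
    by_cases hk : k = i
    · subst hk; simp; omega
    · simp [hk]
  · intro α _
    simp

/-- multivariate Taylor bound -/
lemma cfd_mtaylor {d m : ℕ} {U : Set (EuclideanSpace ℝ (Fin d))} (hU : IsOpen U)
    {f : EuclideanSpace ℝ (Fin d) → ℝ} (hf : ContDiffOn ℝ ((m + 1 : ℕ)) f U)
    (y z : EuclideanSpace ℝ (Fin d)) (K : Set (EuclideanSpace ℝ (Fin d))) (hK : Convex ℝ K)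
    (hKU : K ⊆ U) (hy : y ∈ K) (hz : z ∈ K) (M : ℝ)
    (hM : ∀ α ∈ multiIdx d (m + 1), ∀ ξ ∈ K, |mderiv α f ξ| ≤ M) :
    |f z - ∑ k ∈ Finset.range (m + 1), ∑ α ∈ multiIdx d k,
        cfdc α * mderiv α f y * ∏ i, (z i - y i) ^ α i| ≤
      (∑ α ∈ multiIdx d (m + 1), cfdc α) * M * dist y z ^ (m + 1) := by
  set T : ℕ → ℝ → ℝ := fun k t => ∑ α ∈ multiIdx d k,
    cfdc α * mderiv α f (y + t • (z - y)) * ∏ i, (z i - y i) ^ α i with hTdef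
  have hseg : ∀ t ∈ Set.Icc (0:ℝ) 1, y + t • (z - y) ∈ K := fun t ht =>
    hK.add_smul_sub_mem hy hz ht
  have hc0 : ∀ α : Fin d → ℕ, 0 ≤ cfdc α := fun α => by unfold cfdc; positivity
  have main := cfd_taylor m T ((∑ α ∈ multiIdx d (m + 1), cfdc α) * M * dist y z ^ (m + 1)) ?_ ?_
  · have e0 : T 0 1 = f z := by
      have : multiIdx d 0 = {0} := by
        ext α
        rw [cfd_mem]
        simp [funext_iff]
      have hm : mderiv (0 : Fin d → ℕ) f = f := by
        unfold mderiv
        induction List.finRange d with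
        | nil => rfl
        | cons k l ih => simp [List.foldr_cons]
      simp [hTdef, this, hm, cfdc]
    rw [e0] at main
    simpa [hTdef] using main
  · intro k hk t ht
    have hzU := hKU (hseg t ht)
    have hline : HasDerivAt (fun t : ℝ => y + t • (z - y)) (z - y) t := by
      simpa using ((hasDerivAt_id t).smul_const (z - y)).const_add y
    have h1 : ∀ α ∈ multiIdx d k, HasDerivAt
        (fun t : ℝ => cfdc α * mderiv α f (y + t • (z - y)) * ∏ i, (z i - y i) ^ α i)
        (cfdc α * (∑ i, (z i - y i) * mderiv (α + Pi.single i 1) f (y + t • (z - y))) *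
          ∏ i, (z i - y i) ^ α i) t := by
      intro α hα
      rw [cfd_mem] at hα
      have hdα := cfd_mderiv_diff hU hf α (by omega) hzU
      have h2 := hdα.hasFDerivAt.comp_hasDerivAt t hline
      have h3 : fderiv ℝ (mderiv α f) (y + t • (z - y)) (z - y)
          = ∑ i, (z i - y i) * mderiv (α + Pi.single i 1) f (y + t • (z - y)) := by
        have hv : z - y = ∑ i, (z i - y i) • EuclideanSpace.single i (1:ℝ) := by
          ext j
          simp [Finset.sum_apply, Pi.single_apply]
        conv_lhs => arg 2; rw [hv]
        rw [map_sum]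
        apply Finset.sum_congr rfl
        intro i _
        rw [map_smul, smul_eq_mul, ← cfd_mderiv_succ hU hf α (by omega) i hzU]
        rfl
      rw [h3] at h2
      exact (h2.const_mul _).mul_const _
    refine (HasDerivAt.fun_sum h1).congr_deriv ?_
    simp only [hTdef]
    rw [← cfd_resum]
    apply Finset.sum_congr rfl
    intro α _
    rw [Finset.mul_sum, Finset.sum_mul]
    apply Finset.sum_congr rfl
    intro i _
    rw [cfd_vpow α i (fun i => z i - y i), cfd_fact α i]
    ring
  · intro t ht
    simp only [hTdef]
    refine (Finset.abs_sum_le_sum_abs _ _).trans ?_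
    rw [Finset.sum_mul, Finset.sum_mul]
    apply Finset.sum_le_sum
    intro α hα
    have hM' := hM α hα _ (hseg t ht)
    rw [cfd_mem] at hα
    rw [abs_mul, abs_mul, abs_of_nonneg (hc0 α)]
    have hp : |∏ i, (z i - y i) ^ α i| ≤ dist y z ^ (m + 1) := by
      rw [Finset.abs_prod, ← hα, ← Finset.prod_pow_eq_pow_sum]
      apply Finset.prod_le_prod
      · intros; positivity
      · intro i _
        rw [abs_pow]
        apply pow_le_pow_left₀ (abs_nonneg _)
        rw [dist_comm, dist_eq_norm]
        simpa using PiLp.norm_apply_le (z - y) i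
    have := (abs_nonneg _).trans hM'
    have := hc0 α
    gcongr

lemma cfd_poly {d m : ℕ} (c : (Fin d → ℕ) → ℝ) (y : EuclideanSpace ℝ (Fin d)) :
    ∃ p : MvPolynomial (Fin d) ℝ, p.totalDegree ≤ m ∧ ∀ z : EuclideanSpace ℝ (Fin d),
      MvPolynomial.eval z p = ∑ k ∈ Finset.range (m + 1), ∑ α ∈ multiIdx d k,
        c α * ∏ i, (z i - y i) ^ α i := by
  refine ⟨∑ k ∈ Finset.range (m + 1), ∑ α ∈ multiIdx d k,
    MvPolynomial.C (c α) * ∏ i, (MvPolynomial.X i - MvPolynomial.C (y i)) ^ α i, ?_, ?_⟩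
  · apply MvPolynomial.totalDegree_finsetSum_le
    intro k hk
    apply MvPolynomial.totalDegree_finsetSum_le
    intro α hα
    rw [cfd_mem] at hα
    rw [Finset.mem_range] at hk
    refine (MvPolynomial.totalDegree_mul _ _).trans ?_
    rw [MvPolynomial.totalDegree_C, zero_add]
    refine (MvPolynomial.totalDegree_finsetProd _ _).trans ?_
    have : ∀ i ∈ Finset.univ, ((MvPolynomial.X i - MvPolynomial.C (y i) : MvPolynomial (Fin d) ℝ) ^ α i).totalDegree ≤ α i := by
      intro i _
      refine (MvPolynomial.totalDegree_pow _ _).trans ?_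
      have : (MvPolynomial.X i - MvPolynomial.C (y i) : MvPolynomial (Fin d) ℝ).totalDegree ≤ 1 := by
        refine (MvPolynomial.totalDegree_sub _ _).trans ?_
        simp
      nlinarith
    exact (Finset.sum_le_sum this).trans (by omega)
  · intro z
    simp [map_sum, map_prod]

open MeasureTheory in
lemma cfd_card {d N : ℕ} (hd : 1 ≤ d) (x : Fin N → EuclideanSpace ℝ (Fin d)) (q : ℝ) (hq0 : 0 < q)
    (hsep : ∀ i j, i ≠ j → 2 * q ≤ dist (x i) (x j)) (y : EuclideanSpace ℝ (Fin d)) (n : ℕ)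
    (A : Finset (Fin N)) (hA : ∀ j ∈ A, n * q ≤ dist y (x j) ∧ dist y (x j) < (n + 1) * q) :
    (A.card : ℝ) ≤ 3 ^ d * ((n : ℝ) + 1) ^ (d - 1) := by
  obtain ⟨e, rfl⟩ : ∃ e, d = e + 1 := ⟨d - 1, by omega⟩
  set a : ℝ := ((n - 1 : ℕ) : ℝ) with ha
  have ha0 : 0 ≤ a := Nat.cast_nonneg _
  set V : ℝ := (volume (Metric.ball (0 : EuclideanSpace ℝ (Fin (e + 1))) 1)).toReal with hV
  have hVpos : 0 < V := ENNReal.toReal_pos (Metric.measure_ball_pos volume _ one_pos).ne'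
    measure_ball_lt_top.ne
  have hvol : ∀ (z : EuclideanSpace ℝ (Fin (e + 1))) (r : ℝ), 0 ≤ r →
      (volume (Metric.ball z r)).toReal = r ^ (e + 1) * V := by
    intro z r hr
    rw [Measure.addHaar_ball _ _ hr, ENNReal.toReal_mul, ENNReal.toReal_ofReal (by positivity)]
    simp [hV]
  have hdisj : ∀ i j, i ≠ j → Disjoint (Metric.ball (x i) q) (Metric.ball (x j) q) := by
    intro i j hij
    apply Metric.ball_disjoint_ball
    linarith [hsep i j hij]
  have hunion : (volume (⋃ j ∈ A, Metric.ball (x j) q)).toReal = A.card * (q ^ (e + 1) * V) := by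
    rw [measure_biUnion_finset (fun i _ j _ hij => hdisj i j hij) (fun _ _ => measurableSet_ball),
      ENNReal.toReal_sum (fun _ _ => measure_ball_lt_top.ne)]
    simp [hvol _ _ hq0.le]
  rcases Nat.eq_zero_or_pos n with hn | hn
  · have hsub : (⋃ j ∈ A, Metric.ball (x j) q) ⊆ Metric.ball y (3 * q) := by
      intro z hz
      simp only [Set.mem_iUnion, Metric.mem_ball] at hz ⊢
      obtain ⟨j, hj, hzj⟩ := hz
      have := (hA j hj).2
      have h3 := dist_triangle z (x j) y
      rw [dist_comm (x j) y] at h3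
      simp [hn] at this
      linarith
    have hle := ENNReal.toReal_mono measure_ball_lt_top.ne (measure_mono (μ := volume) hsub)
    rw [hunion, hvol _ _ (by positivity), mul_pow, mul_assoc] at hle
    have := le_of_mul_le_mul_right hle (by positivity)
    simpa [hn] using this
  · have han : a = n - 1 := by rw [ha, Nat.cast_sub hn]; simp
    have hd2 : Disjoint (⋃ j ∈ A, Metric.ball (x j) q) (Metric.ball y (a * q)) := by
      rw [Set.disjoint_left]
      intro z hz hz2
      simp only [Set.mem_iUnion, Metric.mem_ball] at hz hz2
      obtain ⟨j, hj, hzj⟩ := hz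
      have := (hA j hj).1
      have h3 := dist_triangle y z (x j)
      rw [dist_comm y z] at h3
      rw [han] at hz2
      linarith
    have hsub : (⋃ j ∈ A, Metric.ball (x j) q) ∪ (Metric.ball y (a * q)) ⊆
        Metric.ball y ((a + 3) * q) := by
      apply Set.union_subset
      · intro z hz
        simp only [Set.mem_iUnion, Metric.mem_ball] at hz ⊢
        obtain ⟨j, hj, hzj⟩ := hz
        have := (hA j hj).2
        have h3 := dist_triangle z (x j) y
        rw [dist_comm (x j) y] at h3
        rw [han]
        linarith
      · apply Metric.ball_subset_ball
        nlinarith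
    have hle := ENNReal.toReal_mono measure_ball_lt_top.ne (measure_mono (μ := volume) hsub)
    rw [measure_union hd2 measurableSet_ball, ENNReal.toReal_add ?_ measure_ball_lt_top.ne,
      hunion, hvol _ _ (by positivity), hvol _ _ (by positivity), mul_pow, mul_pow, mul_assoc,
      mul_assoc, ← add_mul] at hle
    · have h1 := le_of_mul_le_mul_right hle (by positivity)
      have h2 := cfd_ineq a ha0 e
      have h3 : (a + 1) ^ e ≤ ((n : ℝ) + 1) ^ e := by
        apply pow_le_pow_left₀ (by positivity)
        rw [han]; linarith
      have h4 : (3:ℝ) ^ (e + 1) * (a + 1) ^ e ≤ 3 ^ (e + 1) * ((n : ℝ) + 1) ^ e := by gcongr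
      simp only [Nat.add_sub_cancel]
      linarith
    · exact ((measure_mono (Set.subset_union_left.trans hsub)).trans_lt measure_ball_lt_top).ne

/-- Theorem 3.4, convergence of fast-decaying polynomial reproduction:
if the family `u_j` reproduces polynomials of degree at most `m` and decays fast with
respect to `φ`, then for `f ∈ C^{m+1}` on a neighborhood of `Ω* = closure (conv Ω)`,
`|f(x) − Σ_j f(x_j) u_j(x)| ≤ (Σ_{|α|=m+1} 1/α!) · K · |f|_{C^{m+1}(Ω*)} · h^{m+1}`,
with `K = 3^d C Σ_n (n+1)^{d+m} φ(n)`. -/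
theorem convergence_fast_decay {d N : ℕ} (hd : 1 ≤ d) (m : ℕ)
    (Ω : Set (EuclideanSpace ℝ (Fin d))) (hΩb : Bornology.IsBounded Ω)
    (x : Fin N → EuclideanSpace ℝ (Fin d)) (hx : Function.Injective x)
    (hxΩ : ∀ i, x i ∈ Ω)
    (q h : ℝ) (hq : q = sepRadius x) (hq0 : 0 < q) (hh : h = fillDist x Ω) (hqh : q ≤ h)
    (C : ℝ) (hC : 0 < C)
    (φ : ℝ → ℝ) (hφ0 : ∀ t, 0 ≤ t → 0 ≤ φ t)
    (hφdec : ∀ s t, 0 ≤ s → s ≤ t → φ t ≤ φ s)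
    (hsum : Summable fun n : ℕ => ((n : ℝ) + 1) ^ (d + m) * φ n)
    (u : Fin N → EuclideanSpace ℝ (Fin d) → ℝ)
    (hrep : ∀ p : MvPolynomial (Fin d) ℝ, p.totalDegree ≤ m →
      ∀ y ∈ Ω, ∑ j, MvPolynomial.eval (x j) p * u j y = MvPolynomial.eval y p)
    (hu : ∀ j, ∀ y ∈ Ω, |u j y| ≤ C * φ (dist y (x j) / q))
    (f : EuclideanSpace ℝ (Fin d) → ℝ)
    (U : Set (EuclideanSpace ℝ (Fin d))) (hU : IsOpen U)
    (hΩstarU : closure (convexHull ℝ Ω) ⊆ U)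
    (hf : ContDiffOn ℝ (m + 1) f U)
    (M : ℝ)
    (hM : ∀ α ∈ multiIdx d (m + 1), ∀ ξ ∈ closure (convexHull ℝ Ω), |mderiv α f ξ| ≤ M) :
    ∀ y ∈ Ω,
      |f y - ∑ j, f (x j) * u j y| ≤
        (∑ α ∈ multiIdx d (m + 1), (1 : ℝ) / ((∏ k, Nat.factorial (α k) : ℕ) : ℝ)) *
          (3 ^ d * C * ∑' n : ℕ, ((n : ℝ) + 1) ^ (d + m) * φ n) * M * h ^ (m + 1) := by
  intro y hy
  have hsep : ∀ i j, i ≠ j → 2 * q ≤ dist (x i) (x j) := by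
    intro i j hij
    have : sInf {r : ℝ | ∃ i j : Fin N, i ≠ j ∧ r = dist (x i) (x j)} ≤ dist (x i) (x j) := by
      apply csInf_le
      · refine ⟨0, ?_⟩
        rintro r ⟨i, j, _, rfl⟩
        exact dist_nonneg
      · exact ⟨i, j, hij, rfl⟩
    rw [hq, sepRadius]
    linarith
  have hsubK : Ω ⊆ closure (convexHull ℝ Ω) := (subset_convexHull ℝ Ω).trans subset_closure
  have hK : Convex ℝ (closure (convexHull ℝ Ω)) := (convex_convexHull ℝ Ω).closure
  have hM0 : 0 ≤ M := by
    have : (Pi.single (⟨0, hd⟩ : Fin d) (m + 1) : Fin d → ℕ) ∈ multiIdx d (m + 1) := by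
      rw [cfd_mem]; simp
    exact (abs_nonneg _).trans (hM _ this y (hsubK hy))
  have hf' : ContDiffOn ℝ ((m + 1 : ℕ)) f U := by exact_mod_cast hf
  obtain ⟨p, hpdeg, hp⟩ := cfd_poly (m := m) (fun α => cfdc α * mderiv α f y) y
  have htay : ∀ z ∈ Ω, |f z - MvPolynomial.eval z p| ≤
      (∑ α ∈ multiIdx d (m + 1), cfdc α) * M * dist y z ^ (m + 1) := by
    intro z hz
    rw [hp]
    exact cfd_mtaylor hU hf' y z _ hK hΩstarU (hsubK hy) (hsubK hz) M hM
  set S : ℝ := ∑ α ∈ multiIdx d (m + 1), cfdc α with hS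
  have hS0 : 0 ≤ S := Finset.sum_nonneg fun α _ => by unfold cfdc; positivity
  have hpy : f y = MvPolynomial.eval y p := by
    have := htay y hy
    simp at this
    linarith
  have herr : f y - ∑ j, f (x j) * u j y = - ∑ j, (f (x j) - MvPolynomial.eval (x j) p) * u j y := by
    simp only [sub_mul, Finset.sum_sub_distrib]
    rw [hrep p hpdeg y hy, hpy]
    ring
  rw [herr, abs_neg]
  change _ ≤ S * _ * M * h ^ (m + 1)
  set nn : Fin N → ℕ := fun j => ⌊dist y (x j) / q⌋₊ with hnn
  have hfl : ∀ j, (nn j : ℝ) ≤ dist y (x j) / q := fun j => Nat.floor_le (by positivity)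
  have hfu : ∀ j, dist y (x j) / q < nn j + 1 := fun j => Nat.lt_floor_add_one _
  set W : ℕ → ℝ := fun n => ((n : ℝ) + 1) ^ (m + 1) * φ n with hW
  have hW0 : ∀ n, 0 ≤ W n := fun n => mul_nonneg (by positivity) (hφ0 _ (Nat.cast_nonneg _))
  have hterm : ∀ j, |(f (x j) - MvPolynomial.eval (x j) p) * u j y| ≤
      (S * M * h ^ (m + 1) * C) * W (nn j) := by
    intro j
    have h0 : 0 < h := hq0.trans_le hqh
    rw [abs_mul]
    have h1 := htay (x j) (hxΩ j)
    have h2 : |u j y| ≤ C * φ (nn j) :=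
      (hu j y hy).trans (mul_le_mul_of_nonneg_left (hφdec _ _ (Nat.cast_nonneg _) (hfl j)) hC.le)
    have h3 : dist y (x j) ≤ (nn j + 1) * h := by
      have := (div_lt_iff₀ hq0).1 (hfu j)
      have h4 : ((nn j : ℝ) + 1) * q ≤ (nn j + 1) * h := by gcongr
      linarith
    have h5 : dist y (x j) ^ (m + 1) ≤ ((nn j + 1) * h) ^ (m + 1) :=
      pow_le_pow_left₀ dist_nonneg h3 _
    have h6 : |f (x j) - MvPolynomial.eval (x j) p| ≤ S * M * ((nn j + 1) * h) ^ (m + 1) :=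
      h1.trans (mul_le_mul_of_nonneg_left h5 (by positivity))
    calc _ ≤ (S * M * ((nn j + 1) * h) ^ (m + 1)) * (C * φ (nn j)) :=
          mul_le_mul h6 h2 (abs_nonneg _) (by positivity)
      _ = _ := by simp only [hW, mul_pow]; ring
  have hcount : ∑ j, W (nn j) ≤ 3 ^ d * ∑' n : ℕ, ((n : ℝ) + 1) ^ (d + m) * φ n := by
    have e1 : ∑ j, W (nn j) = ∑ n ∈ Finset.univ.image nn,
        ((Finset.univ.filter fun j => nn j = n).card : ℝ) * W n := by
      rw [Finset.sum_comp W nn]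
      simp
    rw [e1]
    have e2 : ∀ n ∈ Finset.univ.image nn,
        ((Finset.univ.filter fun j => nn j = n).card : ℝ) * W n ≤
        3 ^ d * (((n : ℝ) + 1) ^ (d + m) * φ n) := by
      intro n _
      have hc := cfd_card hd x q hq0 hsep y n (Finset.univ.filter fun j => nn j = n) (by
        intro j hj
        have hj' : nn j = n := by simpa using hj
        have a1 := hfl j
        have a2 := hfu j
        rw [hj'] at a1 a2
        exact ⟨(le_div_iff₀ hq0).1 a1, (div_lt_iff₀ hq0).1 a2⟩)
      refine (mul_le_mul_of_nonneg_right hc (hW0 n)).trans (le_of_eq ?_)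
      obtain ⟨e, rfl⟩ : ∃ e, d = e + 1 := ⟨d - 1, by omega⟩
      simp only [hW, Nat.add_sub_cancel]
      ring
    refine (Finset.sum_le_sum e2).trans ?_
    rw [← Finset.mul_sum]
    refine mul_le_mul_of_nonneg_left ?_ (by positivity)
    exact hsum.sum_le_tsum _ fun n _ => mul_nonneg (by positivity) (hφ0 _ (Nat.cast_nonneg _))
  have h0 : 0 < h := hq0.trans_le hqh
  calc _ ≤ ∑ j, |(f (x j) - MvPolynomial.eval (x j) p) * u j y| := Finset.abs_sum_le_sum_abs _ _
    _ ≤ ∑ j, (S * M * h ^ (m + 1) * C) * W (nn j) := Finset.sum_le_sum fun j _ => hterm j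
    _ = (S * M * h ^ (m + 1) * C) * ∑ j, W (nn j) := by rw [Finset.mul_sum]
    _ ≤ (S * M * h ^ (m + 1) * C) * (3 ^ d * ∑' n : ℕ, ((n : ℝ) + 1) ^ (d + m) * φ n) :=
        mul_le_mul_of_nonneg_left hcount (by positivity)
    _ = _ := by ring
end

section
/- Let d ≥ 1 and let X = {x_1, …, x_N} ⊆ ℝ^d be a finite set of distinct points whose pairwise distances satisfy ‖x_i − x_j‖_2 ≥ 2q for i ≠ j, where q > 0. Then for every x ∈ ℝ^d and every n ∈ ℕ, the number of indices j with n·q ≤ ‖x_j − x‖_2 ≤ (n+1)·q is at most 3^d · (n+1)^{d−1}. -/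
open scoped BigOperators

lemma annulus_pow_aux (b : ℝ) (hb : 0 ≤ b) (k : ℕ) :
    (b + 3) ^ (k + 1) ≤ b ^ (k + 1) + 3 * (k + 1) * (b + 3) ^ k := by
  induction k with
  | zero => norm_num
  | succ k ih =>
    have h1 : b ^ (k + 1) ≤ (b + 3) ^ (k + 1) := by gcongr; linarith
    have h2 := mul_le_mul_of_nonneg_left ih (by linarith : (0:ℝ) ≤ b + 3)
    have e1 : (b + 3) ^ (k + 1 + 1) = (b + 3) * (b + 3) ^ (k + 1) := by ring
    have e2 : (b + 3) * (b ^ (k + 1) + 3 * (k + 1) * (b + 3) ^ k)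
      = b ^ (k + 1 + 1) + 3 * b ^ (k + 1) + 3 * (k + 1) * (b + 3) ^ (k + 1) := by ring
    rw [e2] at h2
    rw [e1]
    push_cast
    nlinarith

lemma annulus_pow_aux2 (n k : ℕ) :
    ((n : ℝ) + 2) ^ (k + 1) ≤
      ((n - 1 : ℕ) : ℝ) ^ (k + 1) + 3 ^ (k + 1) * ((n : ℝ) + 1) ^ k := by
  rcases n with _ | m
  · have : (2 : ℝ) ^ (k + 1) ≤ 3 ^ (k + 1) := by gcongr; norm_num
    simpa using this
  · have h := annulus_pow_aux m (by positivity) k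
    have h1 : ((k : ℝ) + 1) ≤ 2 ^ k := by
      exact_mod_cast Nat.lt_two_pow_self (n := k)
    have h2 : ((m : ℝ) + 3) ^ k * 2 ^ k ≤ 3 ^ k * ((m : ℝ) + 2) ^ k := by
      rw [← mul_pow, ← mul_pow]
      have : (0 : ℝ) ≤ m := by positivity
      gcongr ?_ ^ k
      linarith
    have h3 := mul_le_mul_of_nonneg_left h1 (by positivity : (0 : ℝ) ≤ ((m : ℝ) + 3) ^ k)
    have e1 : (((m + 1 : ℕ) : ℝ) + 2) = m + 3 := by push_cast; ring
    have e2 : (((m + 1 : ℕ) : ℝ) + 1) = m + 2 := by push_cast; ring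
    rw [e1, e2, Nat.add_sub_cancel, pow_succ 3 k]
    linarith

/-- annulus counting for separated point sets: if the points
`x_1, …, x_N ⊆ ℝ^d` satisfy `‖x_i − x_j‖ ≥ 2q` for `i ≠ j`, then at most
`3^d (n+1)^{d−1}` of them lie in the annulus `{y : n q ≤ ‖y − x‖ ≤ (n+1) q}`. -/
theorem annulus_count {d N : ℕ} (hd : 1 ≤ d) (q : ℝ) (hq : 0 < q)
    (x : Fin N → EuclideanSpace ℝ (Fin d))
    (hsep : ∀ i j, i ≠ j → 2 * q ≤ dist (x i) (x j)) :
    ∀ (y : EuclideanSpace ℝ (Fin d)) (n : ℕ),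
      (Finset.univ.filter fun j =>
          (n : ℝ) * q ≤ dist (x j) y ∧ dist (x j) y ≤ ((n : ℝ) + 1) * q).card ≤
        3 ^ d * (n + 1) ^ (d - 1) := by
  intro y n
  set S := Finset.univ.filter fun j =>
          (n : ℝ) * q ≤ dist (x j) y ∧ dist (x j) y ≤ ((n : ℝ) + 1) * q with hS
  obtain ⟨k, rfl⟩ : ∃ k, d = k + 1 := ⟨d - 1, by omega⟩
  let μ : MeasureTheory.Measure (EuclideanSpace ℝ (Fin (k + 1))) := MeasureTheory.volume
  have hball : ∀ z : EuclideanSpace ℝ (Fin (k + 1)), ∀ r : ℝ, 0 ≤ r →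
      μ.real (Metric.ball z r) = r ^ (k + 1) * μ.real (Metric.ball 0 1) := by
    intro z r hr
    have := MeasureTheory.Measure.addHaar_ball μ z hr
    rw [MeasureTheory.measureReal_def, this, ENNReal.toReal_mul,
      ENNReal.toReal_ofReal (by positivity), finrank_euclideanSpace_fin,
      MeasureTheory.measureReal_def]
  have hV : 0 < μ.real (Metric.ball (0 : EuclideanSpace ℝ (Fin (k + 1))) 1) :=
    ENNReal.toReal_pos (Metric.measure_ball_pos μ 0 one_pos).ne' MeasureTheory.measure_ball_lt_top.ne
  have hU : μ.real (⋃ j ∈ S, Metric.ball (x j) q)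
      = ∑ j ∈ S, μ.real (Metric.ball (x j) q) := by
    apply MeasureTheory.measureReal_biUnion_finset
    · intro i _ j _ hij
      apply Metric.ball_disjoint_ball
      linarith [hsep i j hij]
    · intro _ _; exact measurableSet_ball
    · intro _ _; exact MeasureTheory.measure_ball_lt_top.ne
  have hsub : (⋃ j ∈ S, Metric.ball (x j) q) ∪ Metric.ball y (((n - 1 : ℕ) : ℝ) * q)
      ⊆ Metric.ball y (((n : ℝ) + 2) * q) := by
    apply Set.union_subset
    · apply Set.iUnion₂_subset
      intro j hj
      apply Metric.ball_subset_ball'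
      have := (Finset.mem_filter.1 hj).2.2
      linarith
    · apply Metric.ball_subset_ball
      have : ((n - 1 : ℕ) : ℝ) ≤ n := by exact_mod_cast Nat.sub_le n 1
      gcongr
      linarith
  have hdisj : Disjoint (⋃ j ∈ S, Metric.ball (x j) q)
      (Metric.ball y (((n - 1 : ℕ) : ℝ) * q)) := by
    rcases Nat.eq_zero_or_pos n with h0 | h0
    · simp [h0]
    · rw [Set.disjoint_iUnion₂_left]
      intro j hj
      apply Metric.ball_disjoint_ball
      have := (Finset.mem_filter.1 hj).2.1
      rw [Nat.cast_sub h0]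
      push_cast
      linarith
  have hfin : μ (Metric.ball y (((n : ℝ) + 2) * q)) ≠ ⊤ := MeasureTheory.measure_ball_lt_top.ne
  have hm := MeasureTheory.measureReal_mono (μ := μ) hsub hfin
  rw [MeasureTheory.measureReal_union hdisj measurableSet_ball
    (ne_top_of_le_ne_top hfin (MeasureTheory.measure_mono (Set.subset_union_left.trans hsub)))
    MeasureTheory.measure_ball_lt_top.ne, hU,
    Finset.sum_congr rfl (fun j _ => hball (x j) q hq.le), hball y (((n - 1 : ℕ) : ℝ) * q) (by positivity),
    hball y (((n : ℝ) + 2) * q) (by positivity), Finset.sum_const, nsmul_eq_mul, mul_pow, mul_pow] at hm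
  have hW : 0 < q ^ (k + 1) * μ.real (Metric.ball (0 : EuclideanSpace ℝ (Fin (k + 1))) 1) := by
    positivity
  have hm2 : (S.card : ℝ) + ((n - 1 : ℕ) : ℝ) ^ (k + 1) ≤ ((n : ℝ) + 2) ^ (k + 1) := by
    refine le_of_mul_le_mul_right ?_ hW
    linarith
  have := annulus_pow_aux2 n k
  have hfinal : (S.card : ℝ) ≤ 3 ^ (k + 1) * ((n : ℝ) + 1) ^ k := by linarith
  rw [Nat.add_sub_cancel]
  exact_mod_cast hfinal
end

section
/- Let Ω ⊆ ℝ^d be compact satisfying an interior cone condition with angle ϑ ∈ (0, π/2) and radius r > 0, fix m ∈ ℕ, and let h_0, C_1, C_2 > 0 be constants such that for every x ∈ Ω there exist reals ũ_1(x), …, ũ_N(x) with Σ_j p(x_j) ũ_j(x) = p(x) for all polynomials p of degree ≤ m, Σ_j |ũ_j(x)| ≤ C_1, and ũ_j(x) = 0 whenever ‖x − x_j‖_2 > C_2 h_{X,Ω}. Let X = {x_1, …, x_N} ⊆ Ω be quasi-uniform with constant c_{qu} > 0 (i.e. q_X ≤ h_{X,Ω} ≤ c_{qu} q_X) with h_{X,Ω}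 ≤ h_0, and let δ satisfy γ c_γ h_{X,Ω} ≤ δ ≤ c_γ h_{X,Ω} with γ ∈ (0,1), c_γ > 1. Fix ν > 0 and x ∈ Ω, and suppose a*(x) ∈ ℝ^N minimizes Σ_{i=1}^N a_i² / e^{−ν(‖x − x_i‖_2/δ)²} among all a ∈ ℝ^N with Σ_{i=1}^N p(x_i) a_i = p(x) for every polynomial p of degree at most m. Then for every i, |a*_i(x)| ≤ C · e^{−√(ν/2) · ‖x − x_i‖_2 / (c_γ c_{qu} q_X)}, where C = e · C_1 · e^{(ν/2)(C_2/(γ c_γ))²}. -/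
open scoped BigOperators RealInnerProductSpace

/-- The cone `C(x, ξ, ϑ, r) = {x + λ y : ‖y‖ = 1, ⟨y, ξ⟩ ≥ cos ϑ, λ ∈ [0, r]}`. -/
def coneSet {d : ℕ} (x ξ : EuclideanSpace ℝ (Fin d)) (ϑ r : ℝ) :
    Set (EuclideanSpace ℝ (Fin d)) :=
  {p | ∃ z : EuclideanSpace ℝ (Fin d), ‖z‖ = 1 ∧ Real.cos ϑ ≤ ⟪z, ξ⟫ ∧
    ∃ lam ∈ Set.Icc (0 : ℝ) r, p = x + lam • z}

/-- Theorem 4.1: Gaussian moving least squares basis functions decay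
fast: under local polynomial reproduction with constants `h₀, C₁, C₂`, for a
quasi-uniform set `X`, `γ c_γ h ≤ δ ≤ c_γ h`, and `a*(x)` minimizing the
Gaussian-weighted 2-norm subject to the polynomial reproduction constraints,
`|a*_i(x)| ≤ C e^{−√(ν/2) ‖x − x_i‖ / (c_γ c_{qu} q_X)}` with
`C = e C₁ e^{(ν/2)(C₂/(γ c_γ))²}`. -/
theorem mls_gaussian_fast_decay {d N : ℕ} (m : ℕ)
    (Ω : Set (EuclideanSpace ℝ (Fin d))) (hΩc : IsCompact Ω)
    (ϑ r : ℝ) (hϑ : ϑ ∈ Set.Ioo 0 (Real.pi / 2)) (hr : 0 < r)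
    (hcone : ∀ y ∈ Ω, ∃ ξ : EuclideanSpace ℝ (Fin d), ‖ξ‖ = 1 ∧ coneSet y ξ ϑ r ⊆ Ω)
    (x : Fin N → EuclideanSpace ℝ (Fin d)) (hx : Function.Injective x)
    (hxΩ : ∀ i, x i ∈ Ω)
    (h₀ C₁ C₂ : ℝ) (hh₀ : 0 < h₀) (hC₁ : 0 < C₁) (hC₂ : 0 < C₂)
    (hLPR : ∀ y ∈ Ω, ∃ u : Fin N → ℝ,
      (∀ p : MvPolynomial (Fin d) ℝ, p.totalDegree ≤ m →
        ∑ j, MvPolynomial.eval (x j) p * u j = MvPolynomial.eval y p) ∧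
      (∑ j, |u j| ≤ C₁) ∧
      (∀ j, C₂ * fillDist x Ω < dist y (x j) → u j = 0))
    (cqu : ℝ) (hcqu : 0 < cqu)
    (hq0 : 0 < sepRadius x)
    (hqu₁ : sepRadius x ≤ fillDist x Ω) (hqu₂ : fillDist x Ω ≤ cqu * sepRadius x)
    (hhh₀ : fillDist x Ω ≤ h₀)
    (γ cγ δ : ℝ) (hγ : γ ∈ Set.Ioo (0 : ℝ) 1) (hcγ : 1 < cγ)
    (hδ₁ : γ * cγ * fillDist x Ω ≤ δ) (hδ₂ : δ ≤ cγ * fillDist x Ω)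
    (ν : ℝ) (hν : 0 < ν)
    (x₀ : EuclideanSpace ℝ (Fin d)) (hx₀ : x₀ ∈ Ω)
    (astar : Fin N → ℝ)
    (hconstr : ∀ p : MvPolynomial (Fin d) ℝ, p.totalDegree ≤ m →
      ∑ i, MvPolynomial.eval (x i) p * astar i = MvPolynomial.eval x₀ p)
    (hmin : ∀ a : Fin N → ℝ,
      (∀ p : MvPolynomial (Fin d) ℝ, p.totalDegree ≤ m →
        ∑ i, MvPolynomial.eval (x i) p * a i = MvPolynomial.eval x₀ p) →
      ∑ i, astar i ^ 2 / Real.exp (-ν * (dist x₀ (x i) / δ) ^ 2) ≤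
        ∑ i, a i ^ 2 / Real.exp (-ν * (dist x₀ (x i) / δ) ^ 2)) :
    ∀ i, |astar i| ≤
      Real.exp 1 * C₁ * Real.exp (ν / 2 * (C₂ / (γ * cγ)) ^ 2) *
        Real.exp (-(Real.sqrt (ν / 2) * dist x₀ (x i) / (cγ * cqu * sepRadius x))) := by
  intro i
  obtain ⟨u, hu1, hu2, hu3⟩ := hLPR x₀ hx₀
  have hm := hmin u hu1
  set h := fillDist x Ω with hh
  set q := sepRadius x with hq
  obtain ⟨hγ0, hγ1⟩ := hγ
  have hhpos : 0 < h := lt_of_lt_of_le hq0 hqu₁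
  have hcγ0 : 0 < cγ := by linarith
  have hg : 0 < γ * cγ := by positivity
  have hδ : 0 < δ := lt_of_lt_of_le (by positivity) hδ₁
  set K := C₂ / (γ * cγ) with hK
  set E := Real.exp (ν / 2 * K ^ 2) with hE
  have hEpos : 0 < E := Real.exp_pos _
  have hE2 : E ^ 2 = Real.exp (ν * K ^ 2) := by
    rw [hE, ← Real.exp_nat_mul]; congr 1; push_cast; ring
  -- bound for the local polynomial reproduction
  have hub : ∑ j, u j ^ 2 / Real.exp (-ν * (dist x₀ (x j) / δ) ^ 2) ≤ (C₁ * E) ^ 2 := by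
    have h1 : ∀ j, u j ^ 2 / Real.exp (-ν * (dist x₀ (x j) / δ) ^ 2) ≤ |u j| * (C₁ * E ^ 2) := by
      intro j
      by_cases hj : C₂ * h < dist x₀ (x j)
      · simp [hu3 j hj]
      · push Not at hj
        have ht : dist x₀ (x j) / δ ≤ K := by
          rw [hK, div_le_div_iff₀ hδ hg]
          calc dist x₀ (x j) * (γ * cγ) ≤ C₂ * h * (γ * cγ) := by gcongr
            _ = C₂ * (γ * cγ * h) := by ring
            _ ≤ C₂ * δ := by gcongr
        have ht0 : 0 ≤ dist x₀ (x j) / δ := by positivity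
        have huj : |u j| ≤ C₁ :=
          (Finset.single_le_sum (f := fun j => |u j|) (fun k _ => abs_nonneg (u k))
            (Finset.mem_univ j)).trans hu2
        rw [div_eq_mul_inv, ← Real.exp_neg, hE2, ← sq_abs, sq, mul_assoc]
        have : Real.exp (-(-ν * (dist x₀ (x j) / δ) ^ 2)) ≤ Real.exp (ν * K ^ 2) := by
          apply Real.exp_le_exp.2
          have : (dist x₀ (x j) / δ) ^ 2 ≤ K ^ 2 := by gcongr
          nlinarith
        gcongr
    calc _ ≤ ∑ j, |u j| * (C₁ * E ^ 2) := Finset.sum_le_sum fun j _ => h1 j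
      _ = (∑ j, |u j|) * (C₁ * E ^ 2) := by rw [Finset.sum_mul]
      _ ≤ C₁ * (C₁ * E ^ 2) := by gcongr
      _ = _ := by ring
  set t := dist x₀ (x i) / δ with ht
  have ht0 : 0 ≤ t := by positivity
  have hai : astar i ^ 2 / Real.exp (-ν * t ^ 2) ≤ (C₁ * E) ^ 2 :=
    (Finset.single_le_sum
      (f := fun i => astar i ^ 2 / Real.exp (-ν * (dist x₀ (x i) / δ) ^ 2))
      (fun k _ => by positivity) (Finset.mem_univ i)).trans (hm.trans hub)
  rw [div_le_iff₀ (Real.exp_pos _)] at hai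
  have hsq : Real.exp (-ν * t ^ 2) = Real.exp (-(ν / 2 * t ^ 2)) ^ 2 := by
    rw [← Real.exp_nat_mul]; congr 1; push_cast; ring
  rw [hsq, ← mul_pow] at hai
  have habs : |astar i| ≤ C₁ * E * Real.exp (-(ν / 2 * t ^ 2)) :=
    abs_le_of_sq_le_sq hai (by positivity)
  have hs2 : Real.sqrt (ν / 2) ^ 2 = ν / 2 := Real.sq_sqrt (by positivity)
  have hδq : δ ≤ cγ * cqu * q := by
    calc δ ≤ cγ * h := hδ₂
      _ ≤ cγ * (cqu * q) := by gcongr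
      _ = _ := by ring
  have hle : Real.sqrt (ν / 2) * dist x₀ (x i) / (cγ * cqu * q) ≤ Real.sqrt (ν / 2) * t := by
    rw [ht, ← mul_div_assoc]
    gcongr
  have hexp : Real.exp (-(ν / 2 * t ^ 2)) ≤ Real.exp 1 *
      Real.exp (-(Real.sqrt (ν / 2) * dist x₀ (x i) / (cγ * cqu * q))) := by
    rw [← Real.exp_add]
    apply Real.exp_le_exp.2
    have he : ν / 2 * t ^ 2 = (Real.sqrt (ν / 2) * t) ^ 2 := by rw [mul_pow, hs2]
    rw [he]
    nlinarith [sq_nonneg (Real.sqrt (ν / 2) * t - 1), sq_nonneg (Real.sqrt (ν / 2) * t)]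
  calc |astar i| ≤ C₁ * E * Real.exp (-(ν / 2 * t ^ 2)) := habs
    _ ≤ C₁ * E * (Real.exp 1 *
      Real.exp (-(Real.sqrt (ν / 2) * dist x₀ (x i) / (cγ * cqu * q)))) := by gcongr
    _ = _ := by ring
end

section
/- Let Ω ⊆ ℝ^d, fix m ∈ ℕ, and let C_1, C_2 > 0 be constants such that for every x ∈ Ω there exist reals ũ_1(x), …, ũ_N(x) with Σ_j p(x_j) ũ_j(x) = p(x) for all polynomials p of degree ≤ m, Σ_j |ũ_j(x)| ≤ C_1, and ũ_j(x) = 0 whenever ‖x − x_j‖_2 > C_2 h_{X,Ω}. Let X = {x_1, …, x_N} ⊆ Ω be quasi-uniform with constant c_{qu} > 0 (i.e. q_X ≤ h_{X,Ω} ≤ c_{qu} q_X). Let φ : ℝ_{≥0} → ℝ be decreasing and strictly positive, and define weights w_i(x) = φ(‖x − x_i‖_2 / q_X). Fix x ∈ Ω and suppose a*(x) ∈ ℝ^N minimizes Σ_{i=1}^N a_i² / w_i(x) among all a ∈ ℝ^N with Σ_{i=1}^N p(x_i) a_i = p(x) for every polynomial p of degree at most m. Then for every i, |a*_i(x)| ≤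 √(C_1² / φ(C_2 c_{qu})) · √(φ(‖x − x_i‖_2 / q_X)). -/
open scoped BigOperators

/-- moving least squares with general decreasing positive weight
`w_i(x) = φ(‖x − x_i‖/q_X)`: the minimizer `a*(x)` of the weighted 2-norm subject to
the polynomial reproduction constraints satisfies
`|a*_i(x)| ≤ √(C₁²/φ(C₂ c_{qu})) · √(φ(‖x − x_i‖/q_X))`. -/
theorem mls_general_weight_fast_decay {d N : ℕ} (m : ℕ)
    (Ω : Set (EuclideanSpace ℝ (Fin d)))
    (x : Fin N → EuclideanSpace ℝ (Fin d)) (hx : Function.Injective x)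
    (hxΩ : ∀ i, x i ∈ Ω)
    (C₁ C₂ : ℝ) (hC₁ : 0 < C₁) (hC₂ : 0 < C₂)
    (hLPR : ∀ y ∈ Ω, ∃ u : Fin N → ℝ,
      (∀ p : MvPolynomial (Fin d) ℝ, p.totalDegree ≤ m →
        ∑ j, MvPolynomial.eval (x j) p * u j = MvPolynomial.eval y p) ∧
      (∑ j, |u j| ≤ C₁) ∧
      (∀ j, C₂ * fillDist x Ω < dist y (x j) → u j = 0))
    (cqu : ℝ) (hcqu : 0 < cqu)
    (hq0 : 0 < sepRadius x)
    (hqu₁ : sepRadius x ≤ fillDist x Ω) (hqu₂ : fillDist x Ω ≤ cqu * sepRadius x)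
    (φ : ℝ → ℝ) (hφpos : ∀ t, 0 ≤ t → 0 < φ t)
    (hφdec : ∀ s t, 0 ≤ s → s ≤ t → φ t ≤ φ s)
    (x₀ : EuclideanSpace ℝ (Fin d)) (hx₀ : x₀ ∈ Ω)
    (astar : Fin N → ℝ)
    (hconstr : ∀ p : MvPolynomial (Fin d) ℝ, p.totalDegree ≤ m →
      ∑ i, MvPolynomial.eval (x i) p * astar i = MvPolynomial.eval x₀ p)
    (hmin : ∀ a : Fin N → ℝ,
      (∀ p : MvPolynomial (Fin d) ℝ, p.totalDegree ≤ m →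
        ∑ i, MvPolynomial.eval (x i) p * a i = MvPolynomial.eval x₀ p) →
      ∑ i, astar i ^ 2 / φ (dist x₀ (x i) / sepRadius x) ≤
        ∑ i, a i ^ 2 / φ (dist x₀ (x i) / sepRadius x)) :
    ∀ i, |astar i| ≤
      Real.sqrt (C₁ ^ 2 / φ (C₂ * cqu)) *
        Real.sqrt (φ (dist x₀ (x i) / sepRadius x)) := by
  intro i
  obtain ⟨u, hu, hu1, hu0⟩ := hLPR x₀ hx₀
  have hpos : ∀ j, 0 < φ (dist x₀ (x j) / sepRadius x) :=
    fun j => hφpos _ (div_nonneg dist_nonneg hq0.le)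
  have hP : 0 < φ (C₂ * cqu) := hφpos _ (by positivity)
  have h1 : astar i ^ 2 / φ (dist x₀ (x i) / sepRadius x) ≤
      ∑ j, astar j ^ 2 / φ (dist x₀ (x j) / sepRadius x) :=
    Finset.single_le_sum (f := fun j => astar j ^ 2 / φ (dist x₀ (x j) / sepRadius x))
      (fun j _ => div_nonneg (sq_nonneg _) (hpos j).le) (Finset.mem_univ i)
  have h2 := hmin u hu
  have h3 : ∑ j, u j ^ 2 / φ (dist x₀ (x j) / sepRadius x) ≤
      ∑ j, |u j| ^ 2 / φ (C₂ * cqu) := by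
    apply Finset.sum_le_sum
    intro j _
    rw [sq_abs]
    by_cases hj : C₂ * fillDist x Ω < dist x₀ (x j)
    · simp [hu0 j hj]
    · have hle : dist x₀ (x j) / sepRadius x ≤ C₂ * cqu := by
        rw [div_le_iff₀ hq0]
        nlinarith [mul_le_mul_of_nonneg_left hqu₂ hC₂.le]
      exact div_le_div_of_nonneg_left (sq_nonneg _) hP
        (hφdec _ _ (div_nonneg dist_nonneg hq0.le) hle)
  have h4 : ∑ j, |u j| ^ 2 / φ (C₂ * cqu) ≤ C₁ ^ 2 / φ (C₂ * cqu) := by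
    rw [← Finset.sum_div]
    have h5 : ∑ j, |u j| ^ 2 ≤ (∑ j, |u j|) ^ 2 :=
      Finset.sum_sq_le_sq_sum_of_nonneg (fun j _ => abs_nonneg _)
    have h6 : (∑ j, |u j|) ^ 2 ≤ C₁ ^ 2 :=
      pow_le_pow_left₀ (Finset.sum_nonneg fun j _ => abs_nonneg _) hu1 2
    exact div_le_div_of_nonneg_right (h5.trans h6) hP.le
  have h7 := ((h1.trans h2).trans h3).trans h4
  rw [div_le_iff₀ (hpos i)] at h7
  rw [← Real.sqrt_mul (by positivity)]
  exact Real.abs_le_sqrt h7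
end

section
/- Let Ω ⊆ ℝ^d be compact satisfying an interior cone condition with angle ϑ ∈ (0, π/2) and radius r > 0, fix m ∈ ℕ, and let h_0, C_1, C_2 > 0 be constants such that for every x ∈ Ω there exist reals ũ_1(x), …, ũ_N(x) with Σ_j p(x_j) ũ_j(x) = p(x) for all polynomials p of degree ≤ m, Σ_j |ũ_j(x)| ≤ C_1, and ũ_j(x) = 0 whenever ‖x − x_j‖_2 > C_2 h_{X,Ω}. Let X = {x_1, …, x_N} ⊆ Ω be quasi-uniform with constant c_{qu} > 0 with h_{X,Ω} ≤ h_0, and let δ satisfy γ c_γ h_{X,Ω} ≤ δ ≤ c_γ h_{X,Ω} with γ ∈ (0,1), c_γ > 1. Fix ν > 0 and x ∈ Ω, and suppose a*(x) ∈ ℝ^N minimizes Σ_{i=1}^N |a_i| / e^{−ν(‖x − x_i‖_2/δ)²} among all a ∈ ℝ^N with Σ_{i=1}^N p(x_i) a_i = p(x) for every polynomial p of degree at most m. Then for every i, |a*_i(x)| ≤ C · e^{−√ν · ‖x − x_i‖_2 / (c_γ c_{qu} q_X)}, where C = e · C_1 · e^{ν(C_2/(γ c_γ))²}. -/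
open scoped BigOperators RealInnerProductSpace

/-- Theorem 5.1: Gaussian 1-norm basis functions decay fast:
under local polynomial reproduction with constants `h₀, C₁, C₂`, for a quasi-uniform
set `X`, `γ c_γ h ≤ δ ≤ c_γ h`, and `a*(x)` minimizing the Gaussian-weighted 1-norm
subject to the polynomial reproduction constraints,
`|a*_i(x)| ≤ C e^{−√ν ‖x − x_i‖ / (c_γ c_{qu} q_X)}` with
`C = e C₁ e^{ν(C₂/(γ c_γ))²}`. -/
theorem lp_gaussian_fast_decay {d N : ℕ} (m : ℕ)
    (Ω : Set (EuclideanSpace ℝ (Fin d))) (hΩc : IsCompact Ω)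
    (ϑ r : ℝ) (hϑ : ϑ ∈ Set.Ioo 0 (Real.pi / 2)) (hr : 0 < r)
    (hcone : ∀ y ∈ Ω, ∃ ξ : EuclideanSpace ℝ (Fin d), ‖ξ‖ = 1 ∧ coneSet y ξ ϑ r ⊆ Ω)
    (x : Fin N → EuclideanSpace ℝ (Fin d)) (hx : Function.Injective x)
    (hxΩ : ∀ i, x i ∈ Ω)
    (h₀ C₁ C₂ : ℝ) (hh₀ : 0 < h₀) (hC₁ : 0 < C₁) (hC₂ : 0 < C₂)
    (hLPR : ∀ y ∈ Ω, ∃ u : Fin N → ℝ,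
      (∀ p : MvPolynomial (Fin d) ℝ, p.totalDegree ≤ m →
        ∑ j, MvPolynomial.eval (x j) p * u j = MvPolynomial.eval y p) ∧
      (∑ j, |u j| ≤ C₁) ∧
      (∀ j, C₂ * fillDist x Ω < dist y (x j) → u j = 0))
    (cqu : ℝ) (hcqu : 0 < cqu)
    (hq0 : 0 < sepRadius x)
    (hqu₁ : sepRadius x ≤ fillDist x Ω) (hqu₂ : fillDist x Ω ≤ cqu * sepRadius x)
    (hhh₀ : fillDist x Ω ≤ h₀)
    (γ cγ δ : ℝ) (hγ : γ ∈ Set.Ioo (0 : ℝ) 1) (hcγ : 1 < cγ)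
    (hδ₁ : γ * cγ * fillDist x Ω ≤ δ) (hδ₂ : δ ≤ cγ * fillDist x Ω)
    (ν : ℝ) (hν : 0 < ν)
    (x₀ : EuclideanSpace ℝ (Fin d)) (hx₀ : x₀ ∈ Ω)
    (astar : Fin N → ℝ)
    (hconstr : ∀ p : MvPolynomial (Fin d) ℝ, p.totalDegree ≤ m →
      ∑ i, MvPolynomial.eval (x i) p * astar i = MvPolynomial.eval x₀ p)
    (hmin : ∀ a : Fin N → ℝ,
      (∀ p : MvPolynomial (Fin d) ℝ, p.totalDegree ≤ m →
        ∑ i, MvPolynomial.eval (x i) p * a i = MvPolynomial.eval x₀ p) →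
      ∑ i, |astar i| / Real.exp (-ν * (dist x₀ (x i) / δ) ^ 2) ≤
        ∑ i, |a i| / Real.exp (-ν * (dist x₀ (x i) / δ) ^ 2)) :
    ∀ i, |astar i| ≤
      Real.exp 1 * C₁ * Real.exp (ν * (C₂ / (γ * cγ)) ^ 2) *
        Real.exp (-(Real.sqrt ν * dist x₀ (x i) / (cγ * cqu * sepRadius x))) := by
  intro i
  obtain ⟨u, hu1, hu2, hu3⟩ := hLPR x₀ hx₀
  have hm := hmin u hu1
  have hh : 0 < fillDist x Ω := lt_of_lt_of_le hq0 hqu₁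
  generalize fillDist x Ω = h at *
  generalize sepRadius x = q at *
  obtain ⟨hγ0, hγ1⟩ := hγ
  have hcγ0 : 0 < cγ := by linarith
  have hδ : 0 < δ := lt_of_lt_of_le (by positivity) hδ₁
  have hdiv : ∀ (a : ℝ) (j : Fin N), |a| / Real.exp (-ν * (dist x₀ (x j) / δ) ^ 2)
      = |a| * Real.exp (ν * (dist x₀ (x j) / δ) ^ 2) := by
    intro a j
    rw [neg_mul, Real.exp_neg, div_inv_eq_mul]
  simp only [hdiv] at hm
  have h1 : |astar i| * Real.exp (ν * (dist x₀ (x i) / δ) ^ 2) ≤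
      ∑ j, |astar j| * Real.exp (ν * (dist x₀ (x j) / δ) ^ 2) :=
    Finset.single_le_sum (f := fun j => |astar j| * Real.exp (ν * (dist x₀ (x j) / δ) ^ 2))
      (fun j _ => by positivity) (Finset.mem_univ i)
  have h2 : ∑ j, |u j| * Real.exp (ν * (dist x₀ (x j) / δ) ^ 2) ≤
      ∑ j, |u j| * Real.exp (ν * (C₂ / (γ * cγ)) ^ 2) := by
    refine Finset.sum_le_sum fun j _ => ?_
    by_cases hj : C₂ * h < dist x₀ (x j)
    · simp [hu3 j hj]
    · have hj' := not_lt.mp hj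
      have : dist x₀ (x j) / δ ≤ C₂ / (γ * cγ) := by
        rw [div_le_div_iff₀ hδ (by positivity)]
        calc dist x₀ (x j) * (γ * cγ) ≤ C₂ * h * (γ * cγ) := by gcongr
          _ = C₂ * (γ * cγ * h) := by ring
          _ ≤ C₂ * δ := by gcongr
      gcongr
  rw [← Finset.sum_mul] at h2
  have h3 : |astar i| * Real.exp (ν * (dist x₀ (x i) / δ) ^ 2) ≤
      C₁ * Real.exp (ν * (C₂ / (γ * cγ)) ^ 2) :=
    h1.trans (hm.trans (h2.trans (by gcongr)))
  have h4 : Real.sqrt ν * dist x₀ (x i) / (cγ * cqu * q) ≤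
      Real.sqrt ν * (dist x₀ (x i) / δ) := by
    rw [← mul_div_assoc]
    apply div_le_div_of_nonneg_left (by positivity) hδ
    calc δ ≤ cγ * h := hδ₂
      _ ≤ cγ * (cqu * q) := by gcongr
      _ = cγ * cqu * q := by ring
  have h5 : ν * (dist x₀ (x i) / δ) ^ 2 = (Real.sqrt ν * (dist x₀ (x i) / δ)) ^ 2 := by
    rw [mul_pow, Real.sq_sqrt hν.le]
  have h6 : -(ν * (dist x₀ (x i) / δ) ^ 2) ≤
      1 + -(Real.sqrt ν * dist x₀ (x i) / (cγ * cqu * q)) := by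
    rw [h5]
    nlinarith [sq_nonneg (Real.sqrt ν * (dist x₀ (x i) / δ) - 1 / 2)]
  calc |astar i| = |astar i| * Real.exp (ν * (dist x₀ (x i) / δ) ^ 2) *
        Real.exp (-(ν * (dist x₀ (x i) / δ) ^ 2)) := by
        rw [mul_assoc, ← Real.exp_add, add_neg_cancel, Real.exp_zero, mul_one]
    _ ≤ C₁ * Real.exp (ν * (C₂ / (γ * cγ)) ^ 2) *
        Real.exp (1 + -(Real.sqrt ν * dist x₀ (x i) / (cγ * cqu * q))) := by
        gcongr
    _ = _ := by
        rw [Real.exp_add]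
        ring
end

section
/- Let Ω ⊆ ℝ^d, fix m ∈ ℕ, and let C_1, C_2 > 0 be constants such that for every x ∈ Ω there exist reals ũ_1(x), …, ũ_N(x) with Σ_j p(x_j) ũ_j(x) = p(x) for all polynomials p of degree ≤ m, Σ_j |ũ_j(x)| ≤ C_1, and ũ_j(x) = 0 whenever ‖x − x_j‖_2 > C_2 h_{X,Ω}. Let X = {x_1, …, x_N} ⊆ Ω be quasi-uniform with constant c_{qu} > 0 (i.e. q_X ≤ h_{X,Ω} ≤ c_{qu} q_X). Let φ : ℝ_{≥0} → ℝ be decreasing and strictly positive, and define weights w_i(x) = φ(‖x − x_i‖_2 / q_X). Fix x ∈ Ω and suppose a*(x) ∈ ℝ^N minimizes Σ_{i=1}^N |a_i| / w_i(x) among all a ∈ ℝ^N with Σ_{i=1}^N p(x_i) a_i = p(x) for every polynomial p of degree at most m. Then for every i, |a*_i(x)| ≤ (C_1 / φ(C_2 c_{qu})) · φ(‖x − x_i‖_2 / q_X). -/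
open scoped BigOperators

/-- 1-norm approximation with general decreasing positive weight
`w_i(x) = φ(‖x − x_i‖/q_X)`: the minimizer `a*(x)` of the weighted 1-norm subject to
the polynomial reproduction constraints satisfies
`|a*_i(x)| ≤ (C₁/φ(C₂ c_{qu})) · φ(‖x − x_i‖/q_X)`. -/
theorem lp_general_weight_fast_decay {d N : ℕ} (m : ℕ)
    (Ω : Set (EuclideanSpace ℝ (Fin d)))
    (x : Fin N → EuclideanSpace ℝ (Fin d)) (hx : Function.Injective x)
    (hxΩ : ∀ i, x i ∈ Ω)
    (C₁ C₂ : ℝ) (hC₁ : 0 < C₁) (hC₂ : 0 < C₂)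
    (hLPR : ∀ y ∈ Ω, ∃ u : Fin N → ℝ,
      (∀ p : MvPolynomial (Fin d) ℝ, p.totalDegree ≤ m →
        ∑ j, MvPolynomial.eval (x j) p * u j = MvPolynomial.eval y p) ∧
      (∑ j, |u j| ≤ C₁) ∧
      (∀ j, C₂ * fillDist x Ω < dist y (x j) → u j = 0))
    (cqu : ℝ) (hcqu : 0 < cqu)
    (hq0 : 0 < sepRadius x)
    (hqu₁ : sepRadius x ≤ fillDist x Ω) (hqu₂ : fillDist x Ω ≤ cqu * sepRadius x)
    (φ : ℝ → ℝ) (hφpos : ∀ t, 0 ≤ t → 0 < φ t)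
    (hφdec : ∀ s t, 0 ≤ s → s ≤ t → φ t ≤ φ s)
    (x₀ : EuclideanSpace ℝ (Fin d)) (hx₀ : x₀ ∈ Ω)
    (astar : Fin N → ℝ)
    (hconstr : ∀ p : MvPolynomial (Fin d) ℝ, p.totalDegree ≤ m →
      ∑ i, MvPolynomial.eval (x i) p * astar i = MvPolynomial.eval x₀ p)
    (hmin : ∀ a : Fin N → ℝ,
      (∀ p : MvPolynomial (Fin d) ℝ, p.totalDegree ≤ m →
        ∑ i, MvPolynomial.eval (x i) p * a i = MvPolynomial.eval x₀ p) →
      ∑ i, |astar i| / φ (dist x₀ (x i) / sepRadius x) ≤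
        ∑ i, |a i| / φ (dist x₀ (x i) / sepRadius x)) :
    ∀ i, |astar i| ≤
      C₁ / φ (C₂ * cqu) * φ (dist x₀ (x i) / sepRadius x) := by
  intro i
  obtain ⟨u, hu1, hu2, hu3⟩ := hLPR x₀ hx₀
  have hnn : ∀ j, 0 ≤ dist x₀ (x j) / sepRadius x := fun j =>
    div_nonneg dist_nonneg hq0.le
  have hpos : ∀ j, 0 < φ (dist x₀ (x j) / sepRadius x) := fun j => hφpos _ (hnn j)
  have hc : 0 < φ (C₂ * cqu) := hφpos _ (by positivity)
  have h1 : |astar i| / φ (dist x₀ (x i) / sepRadius x) ≤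
      ∑ i, |astar i| / φ (dist x₀ (x i) / sepRadius x) :=
    Finset.single_le_sum (f := fun i => |astar i| / φ (dist x₀ (x i) / sepRadius x))
      (fun j _ => div_nonneg (abs_nonneg _) (hpos j).le) (Finset.mem_univ i)
  have h2 : ∑ j, |u j| / φ (dist x₀ (x j) / sepRadius x) ≤ ∑ j, |u j| / φ (C₂ * cqu) := by
    apply Finset.sum_le_sum
    intro j _
    by_cases hj : C₂ * fillDist x Ω < dist x₀ (x j)
    · simp [hu3 j hj]
    · have hle : dist x₀ (x j) / sepRadius x ≤ C₂ * cqu := by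
        rw [div_le_iff₀ hq0]
        have := mul_le_mul_of_nonneg_left hqu₂ hC₂.le
        linarith [not_lt.mp hj]
      exact div_le_div_of_nonneg_left (abs_nonneg _) hc (hφdec _ _ (hnn j) hle)
  have h3 : ∑ j, |u j| / φ (C₂ * cqu) ≤ C₁ / φ (C₂ * cqu) := by
    rw [← Finset.sum_div]
    exact div_le_div_of_nonneg_right hu2 hc.le
  have h4 := h1.trans ((hmin u hu1).trans (h2.trans h3))
  exact (div_le_iff₀ (hpos i)).mp h4
end

section
/- Let d ≥ 1, m ∈ ℕ, let X = {x_1, …, x_N} ⊆ ℝ^d be π_m(ℝ^d)-unisolvent (i.e. the only polynomial of degree at most m vanishing at all points of X is the zero polynomial), let x ∈ ℝ^d, and let w_1, …, w_N > 0 be positive weights. Then the constraint set S = { a ∈ ℝ^N : Σ_{i=1}^N p(x_i) a_i = p(x) for every polynomial p of degree at most m } is nonempty, the infimum of the functional a ↦ Σ_{i=1}^N |a_i| / w_i over S is finite, and this infimum is attained by some a* ∈ S. -/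
open scoped BigOperators

/-- well-posedness of the 1-norm approximation method: if
`X = {x_1, …, x_N} ⊆ ℝ^d` is `π_m(ℝ^d)`-unisolvent, then for every `x ∈ ℝ^d` and all
positive weights `w_i`, the affine constraint set
`S = {a : Σ_i p(x_i) a_i = p(x) for all p ∈ π_m(ℝ^d)}` is nonempty, the weighted
1-norm functional `a ↦ Σ_i |a_i|/w_i` is bounded below on `S`, and its infimum over
`S` is attained. -/
theorem one_norm_lp_well_posed {d N : ℕ} (hd : 1 ≤ d) (m : ℕ)
    (x : Fin N → EuclideanSpace ℝ (Fin d)) (hx : Function.Injective x)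
    (hunisolvent : ∀ p : MvPolynomial (Fin d) ℝ, p.totalDegree ≤ m →
      (∀ i, MvPolynomial.eval (x i) p = 0) → p = 0)
    (x₀ : EuclideanSpace ℝ (Fin d))
    (w : Fin N → ℝ) (hw : ∀ i, 0 < w i) :
    ({a : Fin N → ℝ | ∀ p : MvPolynomial (Fin d) ℝ, p.totalDegree ≤ m →
        ∑ i, MvPolynomial.eval (x i) p * a i = MvPolynomial.eval x₀ p}.Nonempty) ∧
    (BddBelow ((fun a : Fin N → ℝ => ∑ i, |a i| / w i) ''
        {a : Fin N → ℝ | ∀ p : MvPolynomial (Fin d) ℝ, p.totalDegree ≤ m →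
          ∑ i, MvPolynomial.eval (x i) p * a i = MvPolynomial.eval x₀ p})) ∧
    (∃ astar : Fin N → ℝ,
      (∀ p : MvPolynomial (Fin d) ℝ, p.totalDegree ≤ m →
        ∑ i, MvPolynomial.eval (x i) p * astar i = MvPolynomial.eval x₀ p) ∧
      ∀ a : Fin N → ℝ,
        (∀ p : MvPolynomial (Fin d) ℝ, p.totalDegree ≤ m →
          ∑ i, MvPolynomial.eval (x i) p * a i = MvPolynomial.eval x₀ p) →
        ∑ i, |astar i| / w i ≤ ∑ i, |a i| / w i) := by
  have hne : ∃ a : Fin N → ℝ, ∀ p : MvPolynomial (Fin d) ℝ, p.totalDegree ≤ m →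
        ∑ i, MvPolynomial.eval (x i) p * a i = MvPolynomial.eval x₀ p := by
    let V := MvPolynomial.restrictTotalDegree (Fin d) ℝ m
    let E : V →ₗ[ℝ] (Fin N → ℝ) :=
      (LinearMap.pi fun i => (MvPolynomial.aeval (R := ℝ) (x i : Fin d → ℝ)).toLinearMap) ∘ₗ
        V.subtype
    let L : V →ₗ[ℝ] ℝ :=
      (MvPolynomial.aeval (R := ℝ) (x₀ : Fin d → ℝ)).toLinearMap ∘ₗ V.subtype
    have hE : ∀ (p : V) i, E p i = MvPolynomial.eval (x i) (p : MvPolynomial (Fin d) ℝ) := by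
      intro p i
      simp [E, MvPolynomial.aeval_eq_eval]
    have hL : ∀ (p : V), L p = MvPolynomial.eval x₀ (p : MvPolynomial (Fin d) ℝ) := by
      intro p
      simp [L, MvPolynomial.aeval_eq_eval]
    have hker : LinearMap.ker E = ⊥ := by
      rw [LinearMap.ker_eq_bot']
      intro p hp
      apply Subtype.ext
      refine hunisolvent p ((MvPolynomial.mem_restrictTotalDegree _ _ _).1 p.2) ?_
      intro i
      rw [← hE, hp]
      rfl
    obtain ⟨g, hg⟩ := LinearMap.exists_leftInverse_of_injective E hker
    refine ⟨fun i => L (g (Pi.single i 1)), fun p hp => ?_⟩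
    let q : V := ⟨p, (MvPolynomial.mem_restrictTotalDegree _ _ _).2 hp⟩
    have h1 : g (E q) = q := LinearMap.congr_fun hg q
    have h2 := LinearMap.pi_apply_eq_sum_univ (L ∘ₗ g) (E q)
    have h3 : (L ∘ₗ g) (E q) = MvPolynomial.eval x₀ p := by
      rw [LinearMap.comp_apply, h1, hL]
    rw [← h3, h2]
    refine Finset.sum_congr rfl fun i _ => ?_
    rw [hE, smul_eq_mul, LinearMap.comp_apply]
    have h4 : (Pi.single i 1 : Fin N → ℝ) = fun j => if i = j then 1 else 0 := by
      ext j
      simp [Pi.single_apply, eq_comm]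
    simp only [h4]
    rfl
  have hnn : ∀ (a : Fin N → ℝ) i, 0 ≤ |a i| / w i :=
    fun a i => div_nonneg (abs_nonneg _) (hw i).le
  refine ⟨hne, ⟨0, ?_⟩, ?_⟩
  · rintro _ ⟨a, -, rfl⟩
    exact Finset.sum_nonneg fun i _ => hnn a i
  obtain ⟨b, hb⟩ := hne
  have hcont : Continuous fun a : Fin N → ℝ => ∑ i, |a i| / w i := by fun_prop
  let K : Set (Fin N → ℝ) := {a | (∀ p : MvPolynomial (Fin d) ℝ, p.totalDegree ≤ m →
        ∑ i, MvPolynomial.eval (x i) p * a i = MvPolynomial.eval x₀ p) ∧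
        ∑ i, |a i| / w i ≤ ∑ i, |b i| / w i}
  have hclosed : IsClosed K := by
    have h1 : IsClosed (⋂ p : MvPolynomial (Fin d) ℝ, ⋂ _ : p.totalDegree ≤ m,
        {a : Fin N → ℝ | ∑ i, MvPolynomial.eval (x i) p * a i = MvPolynomial.eval x₀ p}) :=
      isClosed_iInter fun p => isClosed_iInter fun _ =>
        isClosed_eq (by fun_prop) continuous_const
    have h2 := h1.inter (isClosed_le hcont (continuous_const (y := ∑ i, |b i| / w i)))
    convert h2 using 1
    ext a
    simp [K]
  have hK : IsCompact K := by
    refine IsCompact.of_isClosed_subset (isCompact_univ_pi fun i =>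
      isCompact_Icc (a := -((∑ j, |b j| / w j) * w i)) (b := (∑ j, |b j| / w j) * w i))
      hclosed ?_
    rintro a ⟨-, ha⟩ i -
    have h := (Finset.single_le_sum (fun j _ => hnn a j) (Finset.mem_univ i)).trans ha
    exact abs_le.1 ((div_le_iff₀ (hw i)).1 h)
  obtain ⟨s, hs, hmin⟩ := hK.exists_isMinOn ⟨b, hb, le_rfl⟩ hcont.continuousOn
  refine ⟨s, hs.1, fun a ha => ?_⟩
  rcases le_total (∑ i, |a i| / w i) (∑ i, |b i| / w i) with h | h
  · exact hmin (show a ∈ K from ⟨ha, h⟩)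
  · exact hs.2.trans h
end
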